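/- arXiv:1707.05105 — 6 statements merged into one kernel-verified Lean document; each statement's English description precedes it below -/
import Mathlib

section
/- Let G be an elementary abelian 2-group of rank k ≥ 6, and let {x_1,…,x_k} be a generating set for G. Then the Cayley graph on G whose connection set consists of the 2k+1 elements x_1, …, x_k, x_1x_2, x_2x_3, …, x_{k-1}x_k, x_1x_2x_{k-2}x_{k-1}, x_1x_2x_{k-1}x_k is a graphical regular representation of G; that is, its full automorphism group is exactly the right regular representation of G. -/
section Defs

variable {G : Type*} [Group G]

/-- A permutation of `G` is an automorphism of the Cayley digraph `Cay(G,S)`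
(whose arcs are pairs `(x,y)` with `y * x⁻¹ ∈ S`). -/
def IsCayleyAut (S : Set G) (φ : Equiv.Perm G) : Prop :=
  ∀ x y : G, y * x⁻¹ ∈ S ↔ φ y * (φ x)⁻¹ ∈ S

/-- `Cay(G,S)` is a digraphical regular representation of `G`: every automorphism of the
Cayley digraph is a right translation. -/
def IsCayleyDRR (S : Set G) : Prop :=
  ∀ φ : Equiv.Perm G, IsCayleyAut S φ → ∃ g : G, ∀ v : G, φ v = v * g

/-- `G` admits an oriented regular representation. -/
def HasORR (H : Type*) [Group H] : Prop :=
  ∃ S : Set H, S ∩ S⁻¹ = ∅ ∧ IsCayleyDRR S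

/-- `G` is a generalised dihedral group: it is generated by an abelian subgroup `A`
together with an involution `τ` inverting every element of `A`. -/
def IsGeneralizedDihedral (H : Type*) [Group H] : Prop :=
  ∃ A : Subgroup H, (∀ a ∈ A, ∀ b ∈ A, a * b = b * a) ∧
    ∃ τ : H, τ ∉ A ∧ τ * τ = 1 ∧ (∀ a ∈ A, τ * a * τ = a⁻¹) ∧
      ∀ g : H, g ∈ A ∨ ∃ a ∈ A, g = a * τ

/-- The Imrich connection set with respect to the generating tuple `z 0, …, z (k-1)`. -/
def imrichSet (k : ℕ) (z : ℕ → G) : Set G :=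
  z '' Set.Iio k ∪ {g | ∃ i, i + 1 < k ∧ g = z i * z (i + 1)} ∪
    {z 0 * z 1 * z (k - 3) * z (k - 2), z 0 * z 1 * z (k - 2) * z (k - 1)}

end Defs
/-- Adjacency in the local graph, vertices `0..2k`. -/
def ladj (k a b : ℕ) : Prop :=
  (a + 1 = b ∧ b + 2 ≤ 2*k) ∨ (b + 1 = a ∧ a + 2 ≤ 2*k) ∨
  (a + 2 = b ∧ b + 2 ≤ 2*k ∧ a % 2 = 0) ∨ (b + 2 = a ∧ a + 2 ≤ 2*k ∧ b % 2 = 0) ∨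
  (a = 1 ∧ b + 5 = 2*k) ∨ (a = 1 ∧ b + 3 = 2*k) ∨ (a = 1 ∧ b + 1 = 2*k) ∨ (a = 1 ∧ b = 2*k) ∨
  (b = 1 ∧ a + 5 = 2*k) ∨ (b = 1 ∧ a + 3 = 2*k) ∨ (b = 1 ∧ a + 1 = 2*k) ∨ (b = 1 ∧ a = 2*k) ∨
  (a + 5 = 2*k ∧ b + 1 = 2*k) ∨ (b + 5 = 2*k ∧ a + 1 = 2*k) ∨
  (a + 3 = 2*k ∧ b = 2*k) ∨ (b + 3 = 2*k ∧ a = 2*k)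

/-- Supports. -/
def lsup (k n j : ℕ) : Prop :=
  (n + 2 ≤ 2*k ∧ (2*j ≤ n + 1 ∧ n ≤ 2*j+1)) ∨
  (n + 1 = 2*k ∧ (j = 0 ∨ j = 1 ∨ j + 3 = k ∨ j + 2 = k)) ∨
  (n = 2*k ∧ (j = 0 ∨ j = 1 ∨ j + 2 = k ∨ j + 1 = k))

theorem lsup_small {k n j : ℕ} (h : n + 2 ≤ 2*k) : lsup k n j ↔ (2*j ≤ n + 1 ∧ n ≤ 2*j+1) := by
  unfold lsup; omega

theorem lsup_u {k n j : ℕ} (h : n + 1 = 2*k) :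
    lsup k n j ↔ (j = 0 ∨ j = 1 ∨ j + 3 = k ∨ j + 2 = k) := by
  unfold lsup; omega

theorem lsup_v {k n j : ℕ} (h : n = 2*k) :
    lsup k n j ↔ (j = 0 ∨ j = 1 ∨ j + 2 = k ∨ j + 1 = k) := by
  unfold lsup; omega

theorem lsup_line_small {k a b c : ℕ} (hab : a < b) (hbc : b < c) (hc : c + 2 ≤ 2*k)
    (h : ∀ j < k, (lsup k c j ↔ ¬ (lsup k a j ↔ lsup k b j))) :
    a % 2 = 0 ∧ b = a + 1 ∧ c = a + 2 := by
  have h5 := h (a/2) (by omega)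
  have h7 := h ((c+1)/2) (by omega)
  rw [lsup_small hc, lsup_small (by omega), lsup_small (by omega)] at h5 h7
  have e1 : 2 * (a/2) ≤ a + 1 ∧ a ≤ 2 * (a/2) + 1 := by omega
  have e2 : 2 * ((c+1)/2) ≤ c + 1 ∧ c ≤ 2 * ((c+1)/2) + 1 := by omega
  simp only [e1, e2, and_self, true_iff] at h5 h7
  omega

theorem lsup_line_u {k a b c : ℕ} (hk : 6 ≤ k) (hab : a < b) (hb : b + 2 ≤ 2*k) (hc : c + 1 = 2*k)
    (h : ∀ j < k, (lsup k c j ↔ ¬ (lsup k a j ↔ lsup k b j))) :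
    a = 1 ∧ b + 5 = 2*k := by
  obtain ⟨K, rfl⟩ : ∃ K, k = K + 6 := ⟨k-6, by omega⟩
  have h0 := h 0 (by omega)
  have h1 := h 1 (by omega)
  have h2 := h (K+5) (by omega)
  have h3 := h (K+4) (by omega)
  have h4 := h (K+3) (by omega)
  rw [lsup_u hc, lsup_small (by omega), lsup_small (by omega)] at h0 h1 h2 h3 h4
  clear h
  have a1 : a ≤ 1 := by omega
  have b3 : 2*K+7 ≤ b := by omega
  omega

theorem lsup_line_v {k a b c : ℕ} (hk : 6 ≤ k) (hab : a < b) (hb : b + 2 ≤ 2*k) (hc : c = 2*k)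
    (h : ∀ j < k, (lsup k c j ↔ ¬ (lsup k a j ↔ lsup k b j))) :
    a = 1 ∧ b + 3 = 2*k := by
  obtain ⟨K, rfl⟩ : ∃ K, k = K + 6 := ⟨k-6, by omega⟩
  have h0 := h 0 (by omega)
  have h1 := h 1 (by omega)
  have h2 := h (K+5) (by omega)
  have h3 := h (K+4) (by omega)
  have h4 := h (K+3) (by omega)
  rw [lsup_v hc, lsup_small (by omega), lsup_small (by omega)] at h0 h1 h2 h3 h4
  clear h
  have a1 : a ≤ 1 := by omega
  have b3 : 2*K+7 ≤ b := by omega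
  omega

theorem lsup_line_uv {k a b c : ℕ} (hk : 6 ≤ k) (hab : a < b) (hb : b + 1 = 2*k) (hc : c = 2*k)
    (h : ∀ j < k, (lsup k c j ↔ ¬ (lsup k a j ↔ lsup k b j))) : False := by
  obtain ⟨K, rfl⟩ : ∃ K, k = K + 6 := ⟨k-6, by omega⟩
  have h2 := h (K+5) (by omega)
  have h4 := h (K+3) (by omega)
  rw [lsup_v hc, lsup_small (by omega), lsup_u (by omega)] at h2 h4
  clear h
  have a1 : 2*K + 9 ≤ a := by omega
  have b3 : a ≤ 2*K+7 := by omega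
  omega

theorem lsup_line_lt {k a b c : ℕ} (hk : 6 ≤ k) (hab : a < b) (hbc : b < c) (hc : c ≤ 2*k)
    (h : ∀ j < k, (lsup k c j ↔ ¬ (lsup k a j ↔ lsup k b j))) :
    (a % 2 = 0 ∧ b = a + 1 ∧ c = a + 2 ∧ c + 2 ≤ 2*k) ∨ (a = 1 ∧ b + 5 = 2*k ∧ c + 1 = 2*k) ∨
      (a = 1 ∧ b + 3 = 2*k ∧ c = 2*k) := by
  by_cases hc' : c + 2 ≤ 2*k
  · have := lsup_line_small hab hbc hc' h
    exact Or.inl ⟨this.1, this.2.1, this.2.2, hc'⟩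
  · by_cases hu : c + 1 = 2*k
    · have := lsup_line_u hk hab (by omega) hu h
      exact Or.inr (Or.inl ⟨this.1, this.2, hu⟩)
    · have hv : c = 2*k := by omega
      by_cases hb : b + 1 = 2*k
      · exact (lsup_line_uv hk hab hb hv h).elim
      · have := lsup_line_v hk hab (by omega) hv h
        exact Or.inr (Or.inr ⟨this.1, this.2, hv⟩)

theorem lsup_inj {k a b : ℕ} (hk : 6 ≤ k) (ha : a ≤ 2*k) (hb : b ≤ 2*k)
    (h : ∀ j < k, (lsup k a j ↔ lsup k b j)) : a = b := by
  wlog hab : a ≤ b generalizing a b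
  · exact (this hb ha (fun j hj => (h j hj).symm) (by omega)).symm
  by_contra hne
  obtain ⟨K, rfl⟩ : ∃ K, k = K + 6 := ⟨k-6, by omega⟩
  by_cases hb' : b + 2 ≤ 2*(K+6)
  · have h5 := h (a/2) (by omega)
    have h6 := h ((b+1)/2) (by omega)
    rw [lsup_small (by omega), lsup_small (by omega)] at h5 h6
    omega
  · have h0 := h 0 (by omega)
    have h2 := h (K+5) (by omega)
    have h3 := h (K+4) (by omega)
    by_cases hu : b + 1 = 2*(K+6)
    · rw [lsup_small (by omega), lsup_u (by omega)] at h0 h2 h3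
      omega
    · by_cases ha' : a + 1 = 2*(K+6)
      · rw [lsup_u (by omega), lsup_v (by omega)] at h2
        omega
      · rw [lsup_small (by omega), lsup_v (by omega)] at h0 h2 h3
        omega

theorem lsup_ne {k a : ℕ} (hk : 6 ≤ k) (ha : a ≤ 2*k) : ∃ j < k, lsup k a j := by
  unfold lsup
  by_cases ha' : a + 2 ≤ 2*k
  · exact ⟨a/2, by omega, by omega⟩
  · exact ⟨0, by omega, by omega⟩

theorem ladj_symm {k a b : ℕ} (h : ladj k a b) : ladj k b a := by
  rcases h with h | h | h | h | h | h | h | h | h | h | h | h | h | h | h | h <;> (unfold ladj; repeat (first | (left; omega) | right | omega))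

theorem ladj_line {k a b c : ℕ} (h : (a % 2 = 0 ∧ b = a + 1 ∧ c = a + 2 ∧ c + 2 ≤ 2*k) ∨
    (a = 1 ∧ b + 5 = 2*k ∧ c + 1 = 2*k) ∨ (a = 1 ∧ b + 3 = 2*k ∧ c = 2*k)) :
    ladj k a b ∧ ladj k a c ∧ ladj k b c := by
  rcases h with h | h | h <;> refine ⟨?_, ?_, ?_⟩
  all_goals (unfold ladj; repeat (first | (left; omega) | right | omega))

theorem nbr_even {k n m : ℕ} (hn : n % 2 = 0) (hn2 : n + 2 ≤ 2*k) (h : ladj k n m) :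
    m + 1 = n ∨ m + 2 = n ∨ (m = n + 1 ∧ m + 2 ≤ 2*k) ∨ (m = n + 2 ∧ m + 2 ≤ 2*k) := by
  rcases h with h | h | h | h | h | h | h | h | h | h | h | h | h | h | h | h <;> omega

theorem nbr_odd {k n m : ℕ} (hn : n % 2 = 1) (hn1 : n ≠ 1) (hn2 : n + 7 ≤ 2*k) (h : ladj k n m) :
    m + 1 = n ∨ m = n + 1 := by
  rcases h with h | h | h | h | h | h | h | h | h | h | h | h | h | h | h | h <;> omega

theorem nbr_5 {k n m : ℕ} (hk : 6 ≤ k) (hn : n + 5 = 2*k) (h : ladj k n m) :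
    m + 6 = 2*k ∨ m + 4 = 2*k ∨ m = 1 ∨ m + 1 = 2*k := by
  rcases h with h | h | h | h | h | h | h | h | h | h | h | h | h | h | h | h <;> omega

theorem nbr_3 {k n m : ℕ} (hk : 6 ≤ k) (hn : n + 3 = 2*k) (h : ladj k n m) :
    m + 4 = 2*k ∨ m + 2 = 2*k ∨ m = 1 ∨ m = 2*k := by
  rcases h with h | h | h | h | h | h | h | h | h | h | h | h | h | h | h | h <;> omega

theorem nbr_u {k n m : ℕ} (hk : 6 ≤ k) (hn : n + 1 = 2*k) (h : ladj k n m) :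
    m = 1 ∨ m + 5 = 2*k := by
  rcases h with h | h | h | h | h | h | h | h | h | h | h | h | h | h | h | h <;> omega

theorem nbr_v {k n m : ℕ} (hk : 6 ≤ k) (hn : n = 2*k) (h : ladj k n m) :
    m = 1 ∨ m + 3 = 2*k := by
  rcases h with h | h | h | h | h | h | h | h | h | h | h | h | h | h | h | h <;> omega

theorem nbr_1 {k m : ℕ} (hk : 6 ≤ k) (h : ladj k 1 m) :
    m = 0 ∨ m = 2 ∨ m + 5 = 2*k ∨ m + 3 = 2*k ∨ m + 1 = 2*k ∨ m = 2*k := by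
  rcases h with h | h | h | h | h | h | h | h | h | h | h | h | h | h | h | h <;> omega

theorem ladj_le {k n m : ℕ} (hk : 6 ≤ k) (h : ladj k n m) : n ≤ 2*k := by
  rcases h with h | h | h | h | h | h | h | h | h | h | h | h | h | h | h | h <;> omega

theorem ladj_pair {k n : ℕ} (hk : 6 ≤ k) (hn : n ≠ 1) (hn2 : n ≤ 2*k) :
    ∃ P : ℕ → Prop, ∀ m m', ladj k n m → ladj k n m' → m ≠ m' → (P m ↔ P m') → ladj k m m' := by
  have W : ∃ P : ℕ → Prop, ∀ m m', ladj k n m → ladj k n m' → m < m' → (P m ↔ P m') →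
      ladj k m m' := by
    by_cases h1 : n % 2 = 0 ∧ n + 2 ≤ 2*k
    · refine ⟨fun m => m < n, fun m m' hm hm' hne h => ?_⟩
      replace hm := nbr_even h1.1 h1.2 hm
      replace hm' := nbr_even h1.1 h1.2 hm'
      have : (m + 1 = m' ∧ m' + 2 ≤ 2*k) := by omega
      exact Or.inl this
    by_cases h2 : n + 5 = 2*k
    · refine ⟨fun m => m = 1 ∨ m + 1 = 2*k, fun m m' hm hm' hne h => ?_⟩
      replace hm := nbr_5 hk h2 hm
      replace hm' := nbr_5 hk h2 hm'
      have : (m + 6 = 2*k ∧ m' + 4 = 2*k) ∨ (m = 1 ∧ m' + 1 = 2*k) := by omega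
      clear hm hm' h
      rcases this with h | h <;> (unfold ladj; repeat (first | (left; omega) | right | omega))
    by_cases h3 : n + 3 = 2*k
    · refine ⟨fun m => m = 1 ∨ m = 2*k, fun m m' hm hm' hne h => ?_⟩
      replace hm := nbr_3 hk h3 hm
      replace hm' := nbr_3 hk h3 hm'
      have : (m + 4 = 2*k ∧ m' + 2 = 2*k) ∨ (m = 1 ∧ m' = 2*k) := by omega
      clear hm hm' h
      rcases this with h | h <;> (unfold ladj; repeat (first | (left; omega) | right | omega))
    by_cases h4 : n + 1 = 2*k
    · refine ⟨fun m => True, fun m m' hm hm' hne h => ?_⟩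
      replace hm := nbr_u hk h4 hm
      replace hm' := nbr_u hk h4 hm'
      have : m = 1 ∧ m' + 5 = 2*k := by omega
      unfold ladj; repeat (first | (left; omega) | right | omega)
    by_cases h5 : n = 2*k
    · refine ⟨fun m => True, fun m m' hm hm' hne h => ?_⟩
      replace hm := nbr_v hk h5 hm
      replace hm' := nbr_v hk h5 hm'
      have : m = 1 ∧ m' + 3 = 2*k := by omega
      unfold ladj; repeat (first | (left; omega) | right | omega)
    · refine ⟨fun m => True, fun m m' hm hm' hne h => ?_⟩
      replace hm := nbr_odd (by omega) hn (by omega) hm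
      replace hm' := nbr_odd (by omega) hn (by omega) hm'
      have : m + 2 = m' ∧ m' + 2 ≤ 2*k ∧ m % 2 = 0 := by omega
      exact Or.inr (Or.inr (Or.inl this))
  obtain ⟨P, hP⟩ := W
  refine ⟨P, fun m m' hm hm' hne h => ?_⟩
  rcases lt_or_gt_of_ne hne with h' | h'
  · exact hP m m' hm hm' h' h
  · exact ladj_symm (hP m' m hm' hm h' h.symm)

theorem ladj_claw {k n a b c : ℕ} (hk : 6 ≤ k) (ha : ladj k n a) (hb : ladj k n b)
    (hc : ladj k n c) (hab : a ≠ b) (hac : a ≠ c) (hbc : b ≠ c) (hab' : ¬ ladj k a b)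
    (hac' : ¬ ladj k a c) (hbc' : ¬ ladj k b c) : n = 1 := by
  by_contra hn
  obtain ⟨P, hP⟩ := ladj_pair hk hn (ladj_le hk ha)
  have h1 := hP a b ha hb hab
  have h2 := hP a c ha hc hac
  have h3 := hP b c hb hc hbc
  tauto

theorem xor_rot1 {p q r : Prop} (h : r ↔ ¬ (p ↔ q)) : (q ↔ ¬ (p ↔ r)) := by
  by_cases p <;> by_cases q <;> by_cases r <;> simp_all

theorem xor_swap {p q r : Prop} (h : r ↔ ¬ (p ↔ q)) : (r ↔ ¬ (q ↔ p)) := by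
  by_cases p <;> by_cases q <;> by_cases r <;> simp_all

theorem lsup_adj {k a b c : ℕ} (hk : 6 ≤ k) (ha : a ≤ 2*k) (hb : b ≤ 2*k) (hc : c ≤ 2*k)
    (h : ∀ j < k, (lsup k c j ↔ ¬ (lsup k a j ↔ lsup k b j))) : ladj k a b := by
  have hab : a ≠ b := by
    rintro rfl
    obtain ⟨j, hj, h'⟩ := lsup_ne hk hc
    have := h j hj
    tauto
  have hac : a ≠ c := by
    rintro rfl
    obtain ⟨j, hj, h'⟩ := lsup_ne hk hb
    have := h j hj
    tauto
  have hbc : b ≠ c := by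
    rintro rfl
    obtain ⟨j, hj, h'⟩ := lsup_ne hk ha
    have := h j hj
    tauto
  rcases lt_or_gt_of_ne hab with h1 | h1 <;> rcases lt_or_gt_of_ne hac with h2 | h2 <;>
    rcases lt_or_gt_of_ne hbc with h3 | h3
  · exact (ladj_line (lsup_line_lt hk h1 h3 hc h)).1
  · exact (ladj_line (lsup_line_lt hk h2 h3 hb (fun j hj => xor_rot1 (h j hj)))).2.1
  · omega
  · exact (ladj_line (lsup_line_lt hk h2 h1 hb (fun j hj => xor_swap (xor_rot1 (h j hj))))).2.2
  · exact ladj_symm (ladj_line (lsup_line_lt hk h1 h2 hc (fun j hj => xor_swap (h j hj)))).1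
  · omega
  · exact ladj_symm (ladj_line (lsup_line_lt hk h3 h2 ha (fun j hj => xor_rot1 (xor_swap (h j hj))))).2.1
  · exact ladj_symm (ladj_line (lsup_line_lt hk h3 h1 ha (fun j hj => xor_swap (xor_rot1 (xor_swap (h j hj)))))).2.2

/-- non-simplicial -/
def lns (k n : ℕ) : Prop := ∃ a b, a ≤ 2*k ∧ b ≤ 2*k ∧ ladj k n a ∧ ladj k n b ∧ a ≠ b ∧ ¬ ladj k a b

theorem lns_imp {k n : ℕ} (hk : 6 ≤ k) (h : lns k n) :
    n = 1 ∨ n + 5 = 2*k ∨ n + 3 = 2*k ∨ (n % 2 = 0 ∧ 2 ≤ n ∧ n + 4 ≤ 2*k) := by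
  obtain ⟨a, b, -, -, h1, h2, h3, h4⟩ := h
  by_contra hn
  have hn2 := ladj_le hk h1
  wlog hab : a < b generalizing a b
  · exact this b a h2 h1 h3.symm (fun h => h4 (ladj_symm h)) (by omega)
  apply h4
  by_cases c1 : n = 0
  · replace h1 := nbr_even (by omega) (by omega) h1
    replace h2 := nbr_even (by omega) (by omega) h2
    exact Or.inl (by omega)
  by_cases c2 : n + 2 = 2*k
  · replace h1 := nbr_even (by omega) (by omega) h1
    replace h2 := nbr_even (by omega) (by omega) h2
    exact Or.inl (by omega)
  by_cases c3 : n + 1 = 2*k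
  · replace h1 := nbr_u hk c3 h1
    replace h2 := nbr_u hk c3 h2
    have : a = 1 ∧ b + 5 = 2*k := by omega
    unfold ladj; repeat (first | (left; omega) | right | omega)
  by_cases c4 : n = 2*k
  · replace h1 := nbr_v hk c4 h1
    replace h2 := nbr_v hk c4 h2
    have : a = 1 ∧ b + 3 = 2*k := by omega
    unfold ladj; repeat (first | (left; omega) | right | omega)
  · replace h1 := nbr_odd (by omega) (by omega) (by omega) h1
    replace h2 := nbr_odd (by omega) (by omega) (by omega) h2
    exact Or.inr (Or.inr (Or.inl (by omega)))

theorem lns_of {k n : ℕ} (hk : 6 ≤ k) (h : n % 2 = 0 ∧ 2 ≤ n ∧ n + 4 ≤ 2*k) : lns k n := by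
  refine ⟨n-1, n+1, by omega, by omega, ?_, ?_, by omega, fun h => ?_⟩
  · exact Or.inr (Or.inl (by omega))
  · exact Or.inl (by omega)
  · rcases h with h | h | h | h | h | h | h | h | h | h | h | h | h | h | h | h <;> omega

theorem local_rigid {k : ℕ} (hk : 6 ≤ k) (s : ℕ → ℕ) (hs : ∀ n ≤ 2*k, s n ≤ 2*k)
    (hinj : ∀ a ≤ 2*k, ∀ b ≤ 2*k, s a = s b → a = b)
    (hadj : ∀ a ≤ 2*k, ∀ b ≤ 2*k, (ladj k a b ↔ ladj k (s a) (s b))) :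
    ∀ i < k, s (2*i) = 2*i := by
  have A : ∀ a b, a ≤ 2*k → b ≤ 2*k → ladj k a b → ladj k (s a) (s b) :=
    fun a b ha hb h => (hadj a ha b hb).1 h
  have B : ∀ a b, a ≤ 2*k → b ≤ 2*k → ¬ ladj k a b → ¬ ladj k (s a) (s b) :=
    fun a b ha hb h => fun h' => h ((hadj a ha b hb).2 h')
  have I : ∀ a b, a ≤ 2*k → b ≤ 2*k → a ≠ b → s a ≠ s b :=
    fun a b ha hb h h' => h (hinj a ha b hb h')
  have N : ∀ n ≤ 2*k, lns k n → lns k (s n) := by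
    rintro n hn ⟨a, b, ha, hb, h1, h2, h3, h4⟩
    exact ⟨s a, s b, hs a ha, hs b hb, A _ _ hn ha h1, A _ _ hn hb h2, I _ _ ha hb h3, B _ _ ha hb h4⟩
  have nadj : ∀ a b, a < b → ((a = 0 ∧ 2*k ≤ b + 1) ∨ (a + 1 = 2*k ∧ b = 2*k)) → ¬ ladj k a b := by
    intro a b hab hh h
    rcases h with h | h | h | h | h | h | h | h | h | h | h | h | h | h | h | h <;> omega
  have s1 : s 1 = 1 := by
    refine ladj_claw hk (A 1 0 ?_ ?_ ?_) (A 1 (2*k-1) ?_ ?_ ?_) (A 1 (2*k) ?_ ?_ ?_) (I _ _ ?_ ?_ ?_)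
      (I _ _ ?_ ?_ ?_) (I _ _ ?_ ?_ ?_) (B _ _ ?_ ?_ (nadj _ _ ?_ ?_)) (B _ _ ?_ ?_ (nadj _ _ ?_ ?_))
      (B _ _ ?_ ?_ (nadj _ _ ?_ ?_))
    all_goals first | omega | (unfold ladj; repeat (first | (left; omega) | right | omega))
  have n1 := lns_imp hk (N (2*k-6) (by omega) (lns_of hk (by omega)))
  have n2 := lns_imp hk (N (2*k-4) (by omega) (lns_of hk (by omega)))
  have s5 : s (2*k-5) = 2*k-5 := by
    have h1 := A 1 (2*k-5) (by omega) (by omega) (by unfold ladj; repeat (first | (left; omega) | right | omega))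
    have h2 := A (2*k-5) (2*k-6) (by omega) (by omega) (by unfold ladj; repeat (first | (left; omega) | right | omega))
    have h3 := A (2*k-5) (2*k-4) (by omega) (by omega) (by unfold ladj; repeat (first | (left; omega) | right | omega))
    have i1 := I 1 (2*k-6) (by omega) (by omega) (by omega)
    have i2 := I 1 (2*k-4) (by omega) (by omega) (by omega)
    have i3 := I (2*k-6) (2*k-4) (by omega) (by omega) (by omega)
    rw [s1] at h1 i1 i2
    generalize s (2*k-5) = t at *
    generalize s (2*k-6) = u at *
    generalize s (2*k-4) = v at *
    clear A B I N hs hinj hadj nadj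
    rcases nbr_1 hk h1 with h | h | h | h | h | h
    · have h2 := nbr_even (by omega) (by omega) h2
      have h3 := nbr_even (by omega) (by omega) h3
      omega
    · have h2 := nbr_even (by omega) (by omega) h2
      have h3 := nbr_even (by omega) (by omega) h3
      have : u = 4 := by omega
      have : v = 4 := by omega
      omega
    · omega
    · have h2 := nbr_3 hk h h2
      have h3 := nbr_3 hk h h3
      have : u + 4 = 2*k := by omega
      have : v + 4 = 2*k := by omega
      omega
    · have h2 := nbr_u hk h h2
      have h3 := nbr_u hk h h3
      omega
    · have h2 := nbr_v hk h h2
      have h3 := nbr_v hk h h3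
      omega
  have s4 : s (2*k-4) = 2*k-4 ∧ s (2*k-3) = 2*k-3 := by
    have h1 := A 1 (2*k-3) (by omega) (by omega) (by unfold ladj; repeat (first | (left; omega) | right | omega))
    have h2 := A (2*k-5) (2*k-4) (by omega) (by omega) (by unfold ladj; repeat (first | (left; omega) | right | omega))
    have h3 := A (2*k-4) (2*k-3) (by omega) (by omega) (by unfold ladj; repeat (first | (left; omega) | right | omega))
    have i1 := I 1 (2*k-4) (by omega) (by omega) (by omega)
    have i2 := I (2*k-5) (2*k-3) (by omega) (by omega) (by omega)
    rw [s1] at h1 i1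
    rw [s5] at h2 i2
    generalize s (2*k-3) = t at *
    generalize s (2*k-4) = v at *
    clear A B I N hs hinj hadj n1
    replace h1 := nbr_1 hk h1
    replace h2 := nbr_5 hk (by omega) h2
    have h2' : v = 2*k-6 ∨ v = 2*k-4 := by omega
    replace h3 := nbr_even (by omega) (by omega) h3
    rcases h2' with h | h <;> subst h <;> clear h2 n2 <;> omega
  obtain ⟨s4, s3⟩ := s4
  have s2 : s (2*k-2) = 2*k-2 := by
    have h1 := A (2*k-4) (2*k-2) (by omega) (by omega) (by unfold ladj; repeat (first | (left; omega) | right | omega))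
    have h2 := A (2*k-3) (2*k-2) (by omega) (by omega) (by unfold ladj; repeat (first | (left; omega) | right | omega))
    rw [s4] at h1
    rw [s3] at h2
    have h1 := nbr_even (by omega) (by omega) h1
    have h2 := nbr_3 hk (by omega) h2
    omega
  have s6 : s (2*k-6) = 2*k-6 := by
    have h1 := A (2*k-4) (2*k-6) (by omega) (by omega) (by unfold ladj; repeat (first | (left; omega) | right | omega))
    have h2 := A (2*k-5) (2*k-6) (by omega) (by omega) (by unfold ladj; repeat (first | (left; omega) | right | omega))
    rw [s4] at h1
    rw [s5] at h2
    have h1 := nbr_even (by omega) (by omega) h1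
    have h2 := nbr_5 hk (by omega) h2
    omega
  have step : ∀ d, ∀ m, m + d = k - 3 → 1 ≤ m → s (2*m) = 2*m ∧ s (2*m+2) = 2*m+2 := by
    intro d
    induction d with
    | zero =>
      intro m hm _
      obtain rfl : m = k - 3 := by omega
      rw [show 2*(k-3) = 2*k-6 by omega, show 2*k-6+2 = 2*k-4 by omega]
      exact ⟨s6, s4⟩
    | succ d ih =>
      intro m hm hm1
      obtain ⟨h1, h2⟩ := ih (m+1) (by omega) (by omega)
      rw [show 2*(m+1) = 2*m+2 by ring] at h1 h2
      refine ⟨?_, h1⟩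
      have n3 := lns_imp hk (N (2*m) (by omega) (lns_of hk (by omega)))
      have h3 := A (2*m+2) (2*m) (by omega) (by omega) (by unfold ladj; repeat (first | (left; omega) | right | omega))
      have i1 := I (2*m) (2*m+2+2) (by omega) (by omega) (by omega)
      have i2 := I (2*m) (2*k-5) (by omega) (by omega) (by omega)
      rw [h1] at h3
      rw [h2] at i1
      rw [s5] at i2
      generalize s (2*m) = t at *
      clear A B I N hs hinj hadj n1 n2 s1 s2 s3 s4 s5 s6
      replace h3 := nbr_even (by omega) (by omega) h3
      omega
  intro i hi
  rcases Nat.eq_zero_or_pos i with h0 | h0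
  · subst h0
    have t2 := (step (k-4) 1 (by omega) le_rfl).1
    have h1 := A 1 0 (by omega) (by omega) (by unfold ladj; repeat (first | (left; omega) | right | omega))
    have h2 := A 2 0 (by omega) (by omega) (by unfold ladj; repeat (first | (left; omega) | right | omega))
    norm_num at t2 ⊢
    rw [s1] at h1
    rw [t2] at h2
    replace h1 := nbr_1 hk h1
    replace h2 := nbr_even (by omega) (by omega) h2
    omega
  · by_cases h : i ≤ k - 3
    · exact (step (k-3-i) i (by omega) h0).1
    · obtain h | h : i = k - 2 ∨ i = k - 1 := by omega
      · rw [show 2 * i = 2*k-4 by omega]; exact s4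
      · rw [show 2 * i = 2*k-2 by omega]; exact s2

theorem ladj_third {k : ℕ} (hk : 6 ≤ k) (P : ℕ → ℕ → ℕ → Prop)
    (hsw : ∀ a b c, P a b c → P b a c) (hrot : ∀ a b c, P a b c → P a c b)
    (h1 : ∀ i, i + 1 < k → P (2*i) (2*i+1) (2*i+2)) (h2 : P 1 (2*k-5) (2*k-1))
    (h3 : P 1 (2*k-3) (2*k)) {a b : ℕ} (h : ladj k a b) : ∃ c ≤ 2*k, P a b c := by
  have cyc : ∀ a b c, P a b c → P b c a := fun a b c h => hrot _ _ _ (hsw _ _ _ h)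
  have L1 : ∀ a b, a + 1 = b → b + 2 ≤ 2*k → ∃ c ≤ 2*k, P a b c := by
    intro a b hab hb
    subst hab
    rcases Nat.mod_two_eq_zero_or_one a with ha | ha
    · obtain ⟨i, rfl⟩ : ∃ i, a = 2*i := ⟨a/2, by omega⟩
      exact ⟨_, by omega, h1 i (by omega)⟩
    · obtain ⟨i, rfl⟩ : ∃ i, a = 2*i+1 := ⟨a/2, by omega⟩
      exact ⟨2*i, by omega, cyc _ _ _ (h1 i (by omega))⟩
  have L2 : ∀ a b, a + 2 = b → b + 2 ≤ 2*k → a % 2 = 0 → ∃ c ≤ 2*k, P a b c := by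
    intro a b hab hb ha
    subst hab
    obtain ⟨i, rfl⟩ : ∃ i, a = 2*i := ⟨a/2, by omega⟩
    exact ⟨_, by omega, hrot _ _ _ (h1 i (by omega))⟩
  have e5 : ∀ a, a + 5 = 2*k → a = 2*k-5 := by omega
  have e3 : ∀ a, a + 3 = 2*k → a = 2*k-3 := by omega
  have e1 : ∀ a, a + 1 = 2*k → a = 2*k-1 := by omega
  have sw : ∀ a b, (∃ c ≤ 2*k, P b a c) → ∃ c ≤ 2*k, P a b c :=
    fun a b ⟨c, hc, h⟩ => ⟨c, hc, hsw _ _ _ h⟩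
  have A1 : ∃ c ≤ 2*k, P 1 (2*k-5) c := ⟨_, by omega, h2⟩
  have A2 : ∃ c ≤ 2*k, P 1 (2*k-3) c := ⟨_, by omega, h3⟩
  have A3 : ∃ c ≤ 2*k, P 1 (2*k-1) c := ⟨2*k-5, by omega, hrot _ _ _ h2⟩
  have A4 : ∃ c ≤ 2*k, P 1 (2*k) c := ⟨2*k-3, by omega, hrot _ _ _ h3⟩
  have A5 : ∃ c ≤ 2*k, P (2*k-5) (2*k-1) c := ⟨1, by omega, cyc _ _ _ h2⟩
  have A6 : ∃ c ≤ 2*k, P (2*k-3) (2*k) c := ⟨1, by omega, cyc _ _ _ h3⟩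
  rcases h with ⟨h, h'⟩ | ⟨h, h'⟩ | ⟨h, h', h''⟩ | ⟨h, h', h''⟩ | ⟨h, h'⟩ | ⟨h, h'⟩ | ⟨h, h'⟩ |
    ⟨h, h'⟩ | ⟨h, h'⟩ | ⟨h, h'⟩ | ⟨h, h'⟩ | ⟨h, h'⟩ | ⟨h, h'⟩ | ⟨h, h'⟩ | ⟨h, h'⟩ | ⟨h, h'⟩
  · exact L1 _ _ h h'
  · exact sw _ _ (L1 _ _ h h')
  · exact L2 _ _ h h' h''
  · exact sw _ _ (L2 _ _ h h' h'')
  · rw [h, e5 _ h']; exact A1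
  · rw [h, e3 _ h']; exact A2
  · rw [h, e1 _ h']; exact A3
  · rw [h, h']; exact A4
  · rw [h, e5 _ h']; exact sw _ _ A1
  · rw [h, e3 _ h']; exact sw _ _ A2
  · rw [h, e1 _ h']; exact sw _ _ A3
  · rw [h, h']; exact sw _ _ A4
  · rw [e5 _ h, e1 _ h']; exact A5
  · rw [e5 _ h, e1 _ h']; exact sw _ _ A5
  · rw [e3 _ h, h']; exact A6
  · rw [e3 _ h, h']; exact sw _ _ A6

theorem exists_coords {G : Type*} [CommGroup G] [Finite G] (k : ℕ)
    (hexp : ∀ g : G, g ^ 2 = 1) (hcard : Nat.card G = 2 ^ k)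
    (x : ℕ → G) (hgen : Subgroup.closure (x '' Set.Iio k) = ⊤) :
    ∃ c : G → ℕ → Prop, (∀ g h, ∀ j < k, c (g * h) j ↔ ¬ (c g j ↔ c h j)) ∧
      ∀ i < k, ∀ j < k, c (x i) j ↔ i = j := by
  letI : Module (ZMod 2) (Additive G) := AddCommGroup.zmodModule (n := 2) (fun g => hexp g)
  haveI : Fintype (Additive G) := Fintype.ofFinite _
  have hfr : Fintype.card (Fin k) = Module.finrank (ZMod 2) (Additive G) := by
    have h1 := Module.card_eq_pow_finrank (K := ZMod 2) (V := Additive G)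
    rw [ZMod.card, ← Nat.card_eq_fintype_card] at h1
    have h2 : Nat.card (Additive G) = 2 ^ k := hcard
    rw [h2] at h1
    rw [Fintype.card_fin]
    exact Nat.pow_right_injective le_rfl h1
  let b : Fin k → Additive G := fun i => Additive.ofMul (x i)
  have hspan : ⊤ ≤ Submodule.span (ZMod 2) (Set.range b) := by
    rintro g -
    have hg : g.toMul ∈ Subgroup.closure (x '' Set.Iio k) := by rw [hgen]; trivial
    have key : ∀ y : G, y ∈ Subgroup.closure (x '' Set.Iio k) →
        Additive.ofMul y ∈ Submodule.span (ZMod 2) (Set.range b) := by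
      intro y hy
      induction hy using Subgroup.closure_induction with
      | mem y hy =>
        obtain ⟨i, hi, rfl⟩ := hy
        exact Submodule.subset_span ⟨⟨i, hi⟩, rfl⟩
      | one => exact Submodule.zero_mem _
      | mul y z _ _ hy hz => exact Submodule.add_mem _ hy hz
      | inv y _ hy => exact Submodule.neg_mem _ hy
    exact key _ hg
  let B := basisOfTopLeSpanOfCardEqFinrank b hspan hfr
  have hB : ∀ i, B i = b i := fun i => by simp [B]
  have z2 : ∀ u v : ZMod 2, u + v = 1 ↔ ¬ (u = 1 ↔ v = 1) := by decide
  refine ⟨fun g j => ∃ h : j < k, B.repr (Additive.ofMul g) ⟨j, h⟩ = 1, ?_, ?_⟩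
  · intro g h j hj
    simp only [hj, exists_true_left, ofMul_mul, map_add, Finsupp.add_apply]
    exact z2 _ _
  · intro i hi j hj
    have : Additive.ofMul (x i) = B ⟨i, hi⟩ := by rw [hB]
    simp only [hj, exists_true_left, this, Module.Basis.repr_self, Finsupp.single_apply]
    by_cases hij : i = j <;> simp [hij]

/-- Enumeration of the connection set. -/
def lpt {G : Type*} [Group G] (k : ℕ) (x : ℕ → G) (n : ℕ) : G :=
  if n + 2 ≤ 2*k then (if n % 2 = 0 then x (n/2) else x (n/2) * x (n/2+1))
  else if n + 1 = 2*k then x 0 * x 1 * x (k - 3) * x (k - 2)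
  else x 0 * x 1 * x (k - 2) * x (k - 1)

section
variable {G : Type*} [Group G] {k : ℕ} (x : ℕ → G)

theorem lpt_even {i : ℕ} (hi : i < k) : lpt k x (2*i) = x i := by
  unfold lpt
  rw [if_pos (by omega), if_pos (by omega)]
  congr 1; omega

theorem lpt_odd {i : ℕ} (hi : i + 1 < k) : lpt k x (2*i+1) = x i * x (i+1) := by
  unfold lpt
  rw [if_pos (by omega), if_neg (by omega), show (2*i+1)/2 = i by omega]

theorem lpt_u (hk : 6 ≤ k) : lpt k x (2*k-1) = x 0 * x 1 * x (k - 3) * x (k - 2) := by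
  unfold lpt
  rw [if_neg (by omega), if_pos (by omega)]

theorem lpt_v (hk : 6 ≤ k) : lpt k x (2*k) = x 0 * x 1 * x (k - 2) * x (k - 1) := by
  unfold lpt
  rw [if_neg (by omega), if_neg (by omega)]

theorem le_cases (hk : 6 ≤ k) {n : ℕ} (hn : n ≤ 2*k) :
    (∃ i < k, n = 2*i) ∨ (∃ i, i + 1 < k ∧ n = 2*i+1) ∨ n = 2*k-1 ∨ n = 2*k := by
  by_cases h1 : n = 2*k-1
  · simp [h1]
  by_cases h2 : n = 2*k
  · simp [h2]
  rcases Nat.mod_two_eq_zero_or_one n with h | h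
  · exact Or.inl ⟨n/2, by omega, by omega⟩
  · exact Or.inr (Or.inl ⟨n/2, by omega, by omega⟩)

theorem mem_imrich (hk : 6 ≤ k) (g : G) : g ∈ imrichSet k x ↔ ∃ n ≤ 2*k, lpt k x n = g := by
  constructor
  · rintro ((⟨i, hi, rfl⟩ | ⟨i, hi, rfl⟩) | rfl | rfl)
    · have hi : i < k := hi
      exact ⟨2*i, by omega, lpt_even x hi⟩
    · exact ⟨2*i+1, by omega, lpt_odd x hi⟩
    · exact ⟨2*k-1, by omega, lpt_u x hk⟩
    · exact ⟨2*k, by omega, lpt_v x hk⟩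
  · rintro ⟨n, hn, rfl⟩
    rcases le_cases hk hn with ⟨i, hi, rfl⟩ | ⟨i, hi, rfl⟩ | rfl | rfl
    · rw [lpt_even x hi]; exact Or.inl (Or.inl ⟨i, hi, rfl⟩)
    · rw [lpt_odd x hi]; exact Or.inl (Or.inr ⟨i, hi, rfl⟩)
    · rw [lpt_u x hk]; exact Or.inr (Or.inl rfl)
    · rw [lpt_v x hk]; exact Or.inr (Or.inr rfl)

theorem lpt_coord (hk : 6 ≤ k) (c : G → ℕ → Prop)
    (hc : ∀ g h, ∀ j < k, c (g * h) j ↔ ¬ (c g j ↔ c h j))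
    (hx : ∀ i < k, ∀ j < k, c (x i) j ↔ i = j) {n j : ℕ} (hn : n ≤ 2*k) (hj : j < k) :
    c (lpt k x n) j ↔ lsup k n j := by
  rcases le_cases hk hn with ⟨i, hi, rfl⟩ | ⟨i, hi, rfl⟩ | rfl | rfl
  · rw [lpt_even x hi, hx i hi j hj, lsup_small (by omega)]; omega
  · rw [lpt_odd x hi, hc _ _ j hj, hx _ (by omega) j hj, hx _ (by omega) j hj,
      lsup_small (by omega)]; omega
  · rw [lpt_u x hk, hc _ _ j hj, hc _ _ j hj, hc _ _ j hj, hx _ (by omega) j hj,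
      hx _ (by omega) j hj, hx _ (by omega) j hj, hx _ (by omega) j hj, lsup_u (by omega)]
    by_cases h0 : j = 0
    · subst h0; clear hc hx; omega
    by_cases h1 : j = 1
    · subst h1; clear hc hx; omega
    have e0 : ¬ (0 = j) := by omega
    have e1 : ¬ (1 = j) := by omega
    simp only [h0, h1, e0, e1, false_or, iff_true, not_true_eq_false, false_iff, not_not]
    clear hc hx; omega
  · rw [lpt_v x hk, hc _ _ j hj, hc _ _ j hj, hc _ _ j hj, hx _ (by omega) j hj,
      hx _ (by omega) j hj, hx _ (by omega) j hj, hx _ (by omega) j hj, lsup_v (by omega)]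
    by_cases h0 : j = 0
    · subst h0; clear hc hx; omega
    by_cases h1 : j = 1
    · subst h1; clear hc hx; omega
    have e0 : ¬ (0 = j) := by omega
    have e1 : ¬ (1 = j) := by omega
    simp only [h0, h1, e0, e1, false_or, iff_true, not_true_eq_false, false_iff, not_not]
    clear hc hx; omega
end

theorem imrich_comm {G : Type*} [CommGroup G] [Finite G] (k : ℕ) (hk : 6 ≤ k)
    (hexp : ∀ g : G, g ^ 2 = 1) (hcard : Nat.card G = 2 ^ k)
    (x : ℕ → G) (hgen : Subgroup.closure (x '' Set.Iio k) = ⊤) :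
    IsCayleyDRR (imrichSet k x) := by
  obtain ⟨c, hc, hx⟩ := exists_coords k hexp hcard x hgen
  have hinv : ∀ g : G, g⁻¹ = g := fun g => by
    rw [inv_eq_iff_mul_eq_one, ← sq, hexp]
  have hsq : ∀ g : G, g * g = 1 := fun g => by rw [← sq, hexp]
  have pinj : ∀ a ≤ 2*k, ∀ b ≤ 2*k, lpt k x a = lpt k x b → a = b := by
    intro a ha b hb h
    refine lsup_inj hk ha hb fun j hj => ?_
    rw [← lpt_coord x hk c hc hx ha hj, ← lpt_coord x hk c hc hx hb hj, h]
  have padj : ∀ a ≤ 2*k, ∀ b ≤ 2*k,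
      (ladj k a b ↔ lpt k x b * (lpt k x a)⁻¹ ∈ imrichSet k x) := by
    intro a ha b hb
    rw [mem_imrich x hk, hinv]
    constructor
    · intro h
      obtain ⟨d, hd, h⟩ := ladj_third hk
        (fun a b d => lpt k x a * lpt k x b * lpt k x d = 1)
        (fun a b d h => by rw [← h]; ac_rfl) (fun a b d h => by rw [← h]; ac_rfl)
        (fun i hi => by
          rw [lpt_even x (by omega), lpt_odd x hi, show 2*i+2 = 2*(i+1) by ring, lpt_even x hi]
          calc _ = (x i * x i) * (x (i+1) * x (i+1)) := by ac_rfl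
            _ = 1 := by simp [hsq])
        (by
          have o1 := lpt_odd (k := k) x (i := 0) (by omega)
          have o2 := lpt_odd (k := k) x (i := k-3) (by omega)
          rw [show 2*(k-3)+1 = 2*k-5 by omega, show k-3+1 = k-2 by omega] at o2
          simp only [mul_zero, zero_add] at o1
          rw [o1, o2, lpt_u x hk]
          calc _ = (x 0 * x 0) * (x 1 * x 1) * (x (k-3) * x (k-3)) * (x (k-2) * x (k-2)) := by
                ac_rfl
            _ = 1 := by simp [hsq])
        (by
          have o1 := lpt_odd (k := k) x (i := 0) (by omega)
          have o2 := lpt_odd (k := k) x (i := k-2) (by omega)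
          rw [show 2*(k-2)+1 = 2*k-3 by omega, show k-2+1 = k-1 by omega] at o2
          simp only [mul_zero, zero_add] at o1
          rw [o1, o2, lpt_v x hk]
          calc _ = (x 0 * x 0) * (x 1 * x 1) * (x (k-2) * x (k-2)) * (x (k-1) * x (k-1)) := by
                ac_rfl
            _ = 1 := by simp [hsq]) h
      refine ⟨d, hd, ?_⟩
      rw [mul_eq_one_iff_eq_inv, hinv] at h
      rw [← h, mul_comm]
    · rintro ⟨d, hd, h⟩
      refine lsup_adj hk ha hb hd fun j hj => ?_
      rw [← lpt_coord x hk c hc hx ha hj, ← lpt_coord x hk c hc hx hb hj,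
        ← lpt_coord x hk c hc hx hd hj, h, hc _ _ j hj]
      exact not_congr Iff.comm
  have loc : ∀ φ : Equiv.Perm G, IsCayleyAut (imrichSet k x) φ → φ 1 = 1 →
      ∀ i < k, φ (x i) = x i := by
    intro φ hφ h1
    have hS : ∀ n, ∃ m, n ≤ 2*k → m ≤ 2*k ∧ lpt k x m = φ (lpt k x n) := by
      intro n
      by_cases hn : n ≤ 2*k
      · have := (hφ 1 (lpt k x n)).1 (by
          rw [inv_one, mul_one]; exact (mem_imrich x hk _).2 ⟨n, hn, rfl⟩)
        rw [h1, inv_one, mul_one] at this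
        obtain ⟨m, hm, h⟩ := (mem_imrich x hk _).1 this
        exact ⟨m, fun _ => ⟨hm, h⟩⟩
      · exact ⟨0, fun h => absurd h hn⟩
    choose s hs using hS
    have R := local_rigid hk s (fun n hn => (hs n hn).1)
      (fun a ha b hb h => by
        apply pinj a ha b hb
        apply φ.injective
        rw [← (hs a ha).2, ← (hs b hb).2, h])
      (fun a ha b hb => by
        rw [padj a ha b hb, padj _ (hs a ha).1 _ (hs b hb).1, (hs a ha).2, (hs b hb).2]
        exact hφ _ _)
    intro i hi
    have := (hs (2*i) (by omega)).2
    rw [R i hi, lpt_even x hi] at this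
    exact this.symm
  intro φ hφ
  have tr : ∀ v, ∀ i < k, φ (x i * v) = x i * φ v := by
    intro v i hi
    have := loc (((Equiv.mulRight v).trans φ).trans (Equiv.mulRight (φ v)⁻¹)) (by
      intro a b
      have := hφ (a * v) (b * v)
      simp only [Equiv.trans_apply, Equiv.coe_mulRight]
      rw [show b * v * (a * v)⁻¹ = b * a⁻¹ by group] at this
      rw [this]
      rw [show φ (b * v) * (φ v)⁻¹ * (φ (a * v) * (φ v)⁻¹)⁻¹ = φ (b * v) * (φ (a * v))⁻¹ by group])
      (by simp) i hi
    simp only [Equiv.trans_apply, Equiv.coe_mulRight] at this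
    exact mul_inv_eq_iff_eq_mul.1 this
  refine ⟨φ 1, fun v => ?_⟩
  have hv : v ∈ Subgroup.closure (x '' Set.Iio k) := by rw [hgen]; trivial
  have key : ∀ w, φ (v * w) = v * φ w := by
    induction hv using Subgroup.closure_induction with
    | mem y hy =>
      obtain ⟨i, hi, rfl⟩ := hy
      exact fun w => tr w i hi
    | one => simp
    | mul y z _ _ hy hz => intro w; rw [mul_assoc, hy, hz, mul_assoc]
    | inv y _ hy => rw [hinv]; exact hy
  simpa using key 1


/-- **Imrich's Lemma.** If `G` is an elementary abelian 2-group of rank `k ≥ 6` with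
generating set `x 0, …, x (k-1)`, then the Cayley graph of `G` with connection set the
`2k+1` elements `x 0, …, x (k-1), x 0 * x 1, …, x (k-2) * x (k-1),
x 0 * x 1 * x (k-3) * x (k-2), x 0 * x 1 * x (k-2) * x (k-1)` is a graphical regular
representation of `G`: its full automorphism group is exactly the right regular
representation of `G`. -/
theorem imrich_GRR {G : Type*} [Group G] [Finite G] (k : ℕ) (hk : 6 ≤ k)
    (hcomm : ∀ a b : G, a * b = b * a) (hexp : ∀ g : G, g ^ 2 = 1)
    (hcard : Nat.card G = 2 ^ k)
    (x : ℕ → G) (hgen : Subgroup.closure (x '' Set.Iio k) = ⊤) :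
    IsCayleyDRR (imrichSet k x) := by
  letI : CommGroup G := { ‹Group G› with mul_comm := hcomm }
  exact imrich_comm k hk hexp hcard x hgen
end

section
/- Let G be a group, let S be a subset of G, let Γ := Cay(G,S), and let X be a subset of G. If every automorphism φ of Γ fixing the vertex 1 fixes X pointwise, then every automorphism φ of Γ fixing the vertex 1 fixes the subgroup ⟨X⟩ generated by X pointwise. -/
/-- **Nowitz–Watkins Lemma.** If every automorphism of `Cay(G,S)` fixing the vertex `1`
fixes `X` pointwise, then every automorphism of `Cay(G,S)` fixing the vertex `1`
fixes the subgroup generated by `X` pointwise. -/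
theorem nowitz_watkins {G : Type*} [Group G] (S X : Set G)
    (h : ∀ φ : Equiv.Perm G, IsCayleyAut S φ → φ 1 = 1 → ∀ x ∈ X, φ x = x) :
    ∀ φ : Equiv.Perm G, IsCayleyAut S φ → φ 1 = 1 →
      ∀ x ∈ Subgroup.closure X, φ x = x := by
  intro φ hφ h1 x hx
  have key : ∀ g : G, φ (x * g) = x * φ g := by
    induction hx using Subgroup.closure_induction with
    | mem x hx =>
      intro g
      have h2 := h ((Equiv.mulRight g).trans (φ.trans (Equiv.mulRight (φ g)⁻¹))) (by
        intro a b
        have h3 := hφ (a * g) (b * g)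
        simpa [mul_assoc] using h3) (by simp) x hx
      have h3 : φ (x * g) * (φ g)⁻¹ = x := by simpa using h2
      exact mul_inv_eq_iff_eq_mul.mp h3
    | one => simp
    | mul a b _ _ ha hb => intro g; rw [mul_assoc, ha, hb, mul_assoc]
    | inv a _ ha =>
      intro g
      have h2 := ha (a⁻¹ * g)
      rw [mul_inv_cancel_left] at h2
      rw [h2, inv_mul_cancel_left]
  simpa [h1] using key 1
end

section
/- Let A be an abelian 2-group of order 2^k. Assume that A is not elementary abelian and A is not isomorphic to C4 × C2^{k-2}. Then there is a generating set S for A with |S| ≥ 2 and S ∩ S^{-1} = ∅ such that the induced subdigraph of Γ := Cay(A,S) on the vertex set S is weakly connected and has trivial automorphism group, and consequently Γ is an oriented regular representation of A. -/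
section InducedDefs

variable {G : Type*} [Group G]

/-- The subdigraph of `Cay(G,S)` induced on the vertex subset `T` is weakly connected. -/
def InducedWeaklyConnected (S T : Set G) : Prop :=
  ∀ u v : T, Relation.ReflTransGen
    (fun a b : T => (b : G) * (a : G)⁻¹ ∈ S ∨ (a : G) * (b : G)⁻¹ ∈ S) u v

/-- The subdigraph of `Cay(G,S)` induced on the vertex subset `T` has trivial
automorphism group. -/
def InducedAutTrivial (S T : Set G) : Prop :=
  ∀ ψ : Equiv.Perm T,
    (∀ a b : T, (b : G) * (a : G)⁻¹ ∈ S ↔ (↑(ψ b) : G) * (↑(ψ a) : G)⁻¹ ∈ S) → ψ = 1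

end InducedDefs

section Core

variable {A : Type*} [CommGroup A]

/-- A chain of elements, independent modulo squares, as detected by the coordinate
predicates `p`. -/
structure IsChain2 (n : ℕ) (z : ℕ → A) (p : A → ℕ → Prop) : Prop where
  hn : 2 ≤ n
  sq : ∀ i, i < n → z i * z i ≠ 1
  sq2 : ∀ i, i + 1 < n → (z i * z (i + 1)) * (z i * z (i + 1)) ≠ 1
  su : (z 0 * (z 1 * z 1)) * (z 0 * (z 1 * z 1)) ≠ 1
  pm : ∀ a b l, p (a * b) l ↔ ¬ (p a l ↔ p b l)
  pz : ∀ i l, i < n → (p (z i) l ↔ l = i)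

/-- The connection set. -/
def chainSet (n : ℕ) (z : ℕ → A) : Set A :=
  {a | (∃ i, i < n ∧ a = z i) ∨ (∃ i, i + 1 < n ∧ a = z i * z (i + 1)) ∨
    a = z 0 * (z 1 * z 1)}

variable {n : ℕ} {z : ℕ → A} {p : A → ℕ → Prop}

theorem IsChain2.cls (h : IsChain2 n z p) {s : A} (hs : s ∈ chainSet n z) :
    ∃ a d, (∀ l, p s l ↔ (l = a ∨ l = a + d)) ∧
      ((d = 0 ∧ a < n ∧ s = z a) ∨ (d = 1 ∧ a + 1 < n ∧ s = z a * z (a + 1)) ∨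
        (d = 0 ∧ a = 0 ∧ s = z 0 * (z 1 * z 1))) := by
  have hn := h.hn
  rcases hs with ⟨i, hi, rfl⟩ | ⟨i, hi, rfl⟩ | rfl
  · refine ⟨i, 0, fun l => ?_, Or.inl ⟨rfl, hi, rfl⟩⟩
    rw [h.pz i l hi]; omega
  · refine ⟨i, 1, fun l => ?_, Or.inr (Or.inl ⟨rfl, hi, rfl⟩)⟩
    rw [h.pm, h.pz i l (by omega), h.pz (i + 1) l hi]; omega
  · refine ⟨0, 0, fun l => ?_, Or.inr (Or.inr ⟨rfl, rfl, rfl⟩)⟩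
    rw [h.pm, h.pm, h.pz 0 l (by omega), h.pz 1 l (by omega)]; omega

theorem comb_aux {a d b e c f : ℕ} (hd : d = 0 ∨ d = 1) (he : e = 0 ∨ e = 1)
    (hf : f = 0 ∨ f = 1)
    (H : ∀ l, (l = c ∨ l = c + f) ↔ ¬ ((l = a ∨ l = a + d) ↔ (l = b ∨ l = b + e))) :
    (f = 1 ∧ d = 0 ∧ e = 0 ∧ a = c ∧ b = c + 1) ∨
    (f = 1 ∧ d = 0 ∧ e = 0 ∧ b = c ∧ a = c + 1) ∨
    (f = 0 ∧ d = 1 ∧ e = 0 ∧ a = c ∧ b = c + 1) ∨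
    (f = 0 ∧ d = 0 ∧ e = 1 ∧ b = c ∧ a = c + 1) ∨
    (f = 0 ∧ d = 1 ∧ e = 0 ∧ c = b + 1 ∧ a = b) ∨
    (f = 0 ∧ d = 0 ∧ e = 1 ∧ c = a + 1 ∧ a = b) := by
  have h1 := H a
  have h2 := H (a + 1)
  have h3 := H b
  have h4 := H (b + 1)
  have h5 := H c
  have h6 := H (c + 1)
  clear H
  rcases hd with rfl | rfl <;> rcases he with rfl | rfl <;> rcases hf with rfl | rfl <;>
    simp at h1 h2 h3 h4 h5 h6 ⊢ <;> grind

theorem IsChain2.arc (h : IsChain2 n z p) {r s t : A} (hr : r ∈ chainSet n z)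
    (hs : s ∈ chainSet n z) (ht : t ∈ chainSet n z) (e : t = r * s) :
    (∃ i, i + 1 < n ∧ t = z i * z (i + 1) ∧ (s = z i ∨ s = z (i + 1))) ∨
      (t = z 0 * (z 1 * z 1) ∧ (s = z 1 ∨ s = z 0 * z 1)) := by
  have hn := h.hn
  obtain ⟨a, d, hp1, h1⟩ := h.cls hr
  obtain ⟨b, e', hp2, h2⟩ := h.cls hs
  obtain ⟨c, f, hp3, h3⟩ := h.cls ht
  have H := comb_aux (a := a) (b := b) (c := c) (d := d) (e := e') (f := f)
    (by omega) (by omega) (by omega) (fun l => by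
      rw [← hp1, ← hp2, ← hp3, e, h.pm])
  have key1 : ∀ i, i < n → r * s = t * (z i * z i) → False := fun i hi hx =>
    h.sq i hi (by rw [← e] at hx; simpa using hx)
  have key2 : ∀ i, i + 1 < n → r * s = t * ((z i * z (i + 1)) * (z i * z (i + 1))) → False :=
    fun i hi hx => h.sq2 i hi (by rw [← e] at hx; simpa using hx)
  clear hp1 hp2 hp3 e
  rcases H with ⟨rfl, rfl, rfl, rfl, rfl⟩ | ⟨rfl, rfl, rfl, rfl, rfl⟩ | ⟨rfl, rfl, rfl, rfl, rfl⟩ |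
    ⟨rfl, rfl, rfl, rfl, rfl⟩ | ⟨rfl, rfl, rfl, rfl, rfl⟩ | ⟨rfl, rfl, rfl, rfl, rfl⟩ <;>
  simp at h1 h2 h3
  · rcases h1 with h1 | ⟨rfl, h1⟩
    · exact Or.inl ⟨_, h3.1, h3.2, Or.inr h2.2⟩
    · refine (key1 1 (by omega) ?_).elim
      rw [h1, h2.2, h3.2]; ac_rfl
  · rcases h2 with h2 | ⟨rfl, h2⟩
    · exact Or.inl ⟨_, h3.1, h3.2, Or.inl h2.2⟩
    · refine (key1 1 (by omega) ?_).elim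
      rw [h1.2, h2, h3.2]; ac_rfl
  · rcases h3 with h3 | ⟨rfl, h3⟩
    · refine (key1 _ h2.1 ?_).elim
      rw [h1.2, h2.2, h3.2]; ac_rfl
    · exact Or.inr ⟨h3, Or.inl h2.2⟩
  · rcases h3 with h3 | ⟨rfl, h3⟩
    · refine (key1 _ h1.1 ?_).elim
      rw [h1.2, h2.2, h3.2]; ac_rfl
    · exact Or.inr ⟨h3, Or.inr h2.2⟩
  · rcases h2 with h2 | ⟨rfl, h2⟩
    · refine (key1 _ h2.1 ?_).elim
      rw [h1.2, h2.2, h3.2]; ac_rfl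
    · refine (key2 0 (by omega) ?_).elim
      rw [h1.2, h2, h3.2]; ac_rfl
  · rcases h1 with h1 | ⟨rfl, h1⟩
    · refine (key1 _ h1.1 ?_).elim
      rw [h1.2, h2.2, h3.2]; ac_rfl
    · refine (key2 0 (by omega) ?_).elim
      rw [h1, h2.2, h3.2]; ac_rfl

theorem IsChain2.p_one (h : IsChain2 n z p) (l : ℕ) : ¬ p 1 l := by
  have := h.pm 1 1 l
  rw [mul_one] at this
  tauto

theorem IsChain2.disj (h : IsChain2 n z p) : chainSet n z ∩ (chainSet n z)⁻¹ = ∅ := by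
  have hn := h.hn
  ext s
  simp only [Set.mem_inter_iff, Set.mem_inv, Set.mem_empty_iff_false, iff_false, not_and]
  intro hs hr
  obtain ⟨a, d, hp1, h1⟩ := h.cls hs
  obtain ⟨b, e, hp2, h2⟩ := h.cls hr
  have H : ∀ l, (l = a ∨ l = a + d) ↔ (l = b ∨ l = b + e) := fun l => by
    have h3 := h.pm s s⁻¹ l
    rw [mul_inv_cancel] at h3
    have := h.p_one l
    rw [← hp1, ← hp2]; tauto
  have H1 := H a
  have H2 := H b
  have H3 := H (a + d)
  have H4 := H (b + e)
  obtain rfl : a = b := by omega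
  obtain rfl : d = e := by omega
  clear H H1 H2 H3 H4 hp1 hp2
  have e : s * s⁻¹ = 1 := mul_inv_cancel s
  rcases h1 with ⟨rfl, ha, h1⟩ | ⟨rfl, ha, h1⟩ | ⟨rfl, rfl, h1⟩ <;> simp at h2
  · rcases h2 with h2 | ⟨rfl, h2⟩
    · rw [h2.2, h1] at e; exact h.sq _ ha e
    · rw [h2, h1] at e; apply h.sq2 0 (by omega); rw [← e]; ac_rfl
  · rw [h2.2, h1] at e; exact h.sq2 _ ha e
  · rcases h2 with h2 | h2
    · rw [h2.2, h1] at e; apply h.sq2 0 (by omega); rw [← e]; ac_rfl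
    · rw [h2, h1] at e; exact h.su e

theorem IsChain2.z_inj (h : IsChain2 n z p) {i j : ℕ} (hi : i < n) (hj : j < n)
    (e : z i = z j) : i = j := by
  have := h.pz i i hi
  rw [e, h.pz j i hj] at this
  tauto

theorem IsChain2.z_ne_zz (h : IsChain2 n z p) {i j : ℕ} (hi : i < n) (hj : j + 1 < n) :
    z i ≠ z j * z (j + 1) := by
  intro e
  have h1 := h.pz i j hi
  have h2 := h.pz i (j + 1) hi
  rw [e, h.pm, h.pz j _ (by omega), h.pz _ _ hj] at h1 h2
  omega

theorem IsChain2.zz_inj (h : IsChain2 n z p) {i j : ℕ} (hi : i + 1 < n) (hj : j + 1 < n)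
    (e : z i * z (i + 1) = z j * z (j + 1)) : i = j := by
  have h1 := h.pm (z i) (z (i + 1)) i
  have h2 := h.pm (z i) (z (i + 1)) (i + 1)
  rw [e, h.pm, h.pz j _ (by omega), h.pz _ _ hj, h.pz _ _ hi, h.pz i _ (by omega)] at h1 h2
  omega

theorem IsChain2.u_ne_z (h : IsChain2 n z p) {i : ℕ} (hi : i < n) :
    z 0 * (z 1 * z 1) ≠ z i := by
  have hn := h.hn
  intro e
  have h1 := h.pz i 0 hi
  rw [← e, h.pm, h.pm, h.pz 0 _ (by omega)] at h1
  obtain rfl : i = 0 := by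
    have : ¬ ¬ (p (z 1) 0 ↔ p (z 1) 0) := by tauto
    by_contra hh
    have : ¬ (0 = i) := fun h => hh h.symm
    tauto
  exact h.sq 1 (by omega) (by simpa using e)

theorem IsChain2.u_ne_zz (h : IsChain2 n z p) {i : ℕ} (hi : i + 1 < n) :
    z 0 * (z 1 * z 1) ≠ z i * z (i + 1) := by
  have hn := h.hn
  intro e
  have h1 := h.pm (z i) (z (i + 1)) i
  have h2 := h.pm (z i) (z (i + 1)) (i + 1)
  rw [← e, h.pm, h.pm, h.pz 0 _ (by omega), h.pz _ _ hi, h.pz i _ (by omega),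
    h.pz 1 _ (by omega)] at h1 h2
  omega

theorem zmem {i : ℕ} (hi : i < n) : z i ∈ chainSet n z := Or.inl ⟨i, hi, rfl⟩

theorem zzmem {i : ℕ} (hi : i + 1 < n) : z i * z (i + 1) ∈ chainSet n z :=
  Or.inr (Or.inl ⟨i, hi, rfl⟩)

theorem umem : z 0 * (z 1 * z 1) ∈ chainSet n z := Or.inr (Or.inr rfl)

theorem IsChain2.rigid (h : IsChain2 n z p) :
    InducedAutTrivial (chainSet n z) (chainSet n z) := by
  have hn := h.hn
  intro ψ hψ
  -- arcs of the image
  have arc : ∀ s t : A, ∀ hs : s ∈ chainSet n z, ∀ ht : t ∈ chainSet n z,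
      (∃ r ∈ chainSet n z, t = r * s) →
      (∃ i, i + 1 < n ∧ (ψ ⟨t, ht⟩ : A) = z i * z (i + 1) ∧
        ((ψ ⟨s, hs⟩ : A) = z i ∨ (ψ ⟨s, hs⟩ : A) = z (i + 1))) ∨
      ((ψ ⟨t, ht⟩ : A) = z 0 * (z 1 * z 1) ∧
        ((ψ ⟨s, hs⟩ : A) = z 1 ∨ (ψ ⟨s, hs⟩ : A) = z 0 * z 1)) := by
    rintro s t hs ht ⟨r, hr, e⟩
    have h1 := (hψ ⟨s, hs⟩ ⟨t, ht⟩).1 (by simpa [e] using hr)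
    exact h.arc h1 (ψ ⟨s, hs⟩).2 (ψ ⟨t, ht⟩).2 (by simp)
  have inj : ∀ s t : A, ∀ hs : s ∈ chainSet n z, ∀ ht : t ∈ chainSet n z,
      (ψ ⟨t, ht⟩ : A) = s → (ψ ⟨s, hs⟩ : A) = s → s = t := by
    intro s t hs ht h1 h2
    have := ψ.injective (Subtype.ext (h1.trans h2.symm))
    exact (congrArg Subtype.val this).symm
  have f01 : (ψ ⟨z 0 * z 1, zzmem (by omega)⟩ : A) = z 0 * z 1 := by
    rcases arc (z 0) (z 0 * z 1) (zmem (by omega)) (zzmem (by omega))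
      ⟨z 1, zmem (by omega), mul_comm _ _⟩ with ⟨i, hi, h1, -⟩ | ⟨h1, -⟩ <;>
    rcases arc (z 0 * z 1) _ (zzmem (by omega)) umem
      ⟨z 1, zmem (by omega), by ac_rfl⟩ with ⟨j, hj, -, h2 | h2⟩ | ⟨-, h2 | h2⟩
    · exact (h.z_ne_zz (by omega) hi (h2.symm.trans h1)).elim
    · exact (h.z_ne_zz (by omega) hi (h2.symm.trans h1)).elim
    · exact (h.z_ne_zz (by omega) hi (h2.symm.trans h1)).elim
    · exact h2
    · exact (h.u_ne_z (by omega) (h1.symm.trans h2)).elim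
    · exact (h.u_ne_z (by omega) (h1.symm.trans h2)).elim
    · exact (h.u_ne_z (by omega) (h1.symm.trans h2)).elim
    · exact h2
  have fu : (ψ ⟨_, umem⟩ : A) = z 0 * (z 1 * z 1) := by
    rcases arc (z 0 * z 1) _ (zzmem (by omega)) umem
      ⟨z 1, zmem (by omega), by ac_rfl⟩ with ⟨j, hj, -, h2 | h2⟩ | ⟨h1, -⟩
    · exact (h.z_ne_zz (j := 0) (by omega) (by omega) (h2.symm.trans f01)).elim
    · exact (h.z_ne_zz (j := 0) (by omega) (by omega) (h2.symm.trans f01)).elim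
    · exact h1
  have f1 : (ψ ⟨z 1, zmem (by omega)⟩ : A) = z 1 := by
    rcases arc (z 1) _ (zmem (by omega)) umem
      ⟨z 0 * z 1, zzmem (by omega), by ac_rfl⟩ with ⟨j, hj, h1, -⟩ | ⟨-, h2 | h2⟩
    · exact (h.u_ne_zz hj (fu.symm.trans h1)).elim
    · exact h2
    · exact (h.z_ne_zz (j := 0) (by omega) (by omega)
        (inj _ _ _ _ h2 f01).symm).elim
  have f0 : (ψ ⟨z 0, zmem (by omega)⟩ : A) = z 0 := by
    rcases arc (z 0) (z 0 * z 1) (zmem (by omega)) (zzmem (by omega))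
      ⟨z 1, zmem (by omega), mul_comm _ _⟩ with ⟨i, hi, h1, h2⟩ | ⟨h1, -⟩
    · obtain rfl := h.zz_inj (j := i) (i := 0) (by omega) hi (f01.symm.trans h1)
      rcases h2 with h2 | h2
      · exact h2
      · have := h.z_inj (by omega) (by omega) (inj _ _ _ _ h2 f1)
        omega
    · exact (h.u_ne_zz (i := 0) (by omega) (h1.symm.trans f01)).elim
  have main : ∀ i, ∀ hi : i + 1 < n, (ψ ⟨z i * z (i + 1), zzmem hi⟩ : A) = z i * z (i + 1) ∧
      (ψ ⟨z (i + 1), zmem hi⟩ : A) = z (i + 1) := by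
    intro i
    induction i with
    | zero => exact fun hi => ⟨f01, f1⟩
    | succ i ih =>
      intro hi
      obtain ⟨ih1, ih2⟩ := ih (by omega)
      have g1 : (ψ ⟨z (i + 1) * z (i + 1 + 1), zzmem hi⟩ : A) = z (i + 1) * z (i + 1 + 1) := by
        rcases arc (z (i + 1)) (z (i + 1) * z (i + 1 + 1)) (zmem (by omega)) (zzmem hi)
          ⟨_, zmem hi, mul_comm _ _⟩ with ⟨j, hj, h1, h2⟩ | ⟨h1, -⟩
        · rw [ih2] at h2
          rcases h2 with h2 | h2
          · obtain rfl := h.z_inj (by omega) (by omega) h2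
            exact h1
          · have := h.z_inj (by omega) (by omega) h2
            obtain rfl : i = j := by omega
            have := h.zz_inj hj hi (inj _ _ (zzmem hj) _ h1 ih1)
            omega
        · exact (h.u_ne_zz hi (inj _ _ umem _ h1 fu)).elim
      refine ⟨g1, ?_⟩
      rcases arc (z (i + 1 + 1)) (z (i + 1) * z (i + 1 + 1)) (zmem (by omega)) (zzmem hi)
          ⟨_, zmem (by omega), rfl⟩ with ⟨j, hj, h1, h2⟩ | ⟨h1, -⟩
      · obtain rfl := h.zz_inj hi hj (g1.symm.trans h1)
        rcases h2 with h2 | h2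
        · have := h.z_inj (by omega) (by omega) (inj _ _ (zmem (by omega)) _ h2 ih2)
          omega
        · exact h2
      · exact (h.u_ne_zz hi (h1.symm.trans g1)).elim
  ext ⟨s, hs⟩
  simp only [Equiv.Perm.coe_one, id_eq]
  rcases hs with ⟨i, hi, rfl⟩ | ⟨i, hi, rfl⟩ | rfl
  · rcases i with _ | i
    · exact f0
    · exact (main i hi).2
  · exact (main i hi).1
  · exact fu

theorem IsChain2.conn (h : IsChain2 n z p) :
    InducedWeaklyConnected (chainSet n z) (chainSet n z) := by
  have hn := h.hn
  set R : chainSet n z → chainSet n z → Prop :=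
    (fun a b => (b : A) * (a : A)⁻¹ ∈ chainSet n z ∨ (a : A) * (b : A)⁻¹ ∈ chainSet n z) with hR
  have symR : ∀ a b, R a b → R b a := fun a b hab => hab.symm
  have sym : ∀ a b, Relation.ReflTransGen R a b → Relation.ReflTransGen R b a := by
    intro a b hab
    induction hab with
    | refl => exact .refl
    | tail _ h2 ih => exact .head (symR _ _ h2) ih
  have st : ∀ a r b : A, ∀ ha : a ∈ chainSet n z, ∀ hb : b ∈ chainSet n z, r ∈ chainSet n z →
      b = r * a → R ⟨a, ha⟩ ⟨b, hb⟩ := by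
    intro a r b ha hb hr e
    left
    simpa [e] using hr
  have key : ∀ i, ∀ hi : i < n,
      Relation.ReflTransGen R ⟨z 0, zmem (by omega)⟩ ⟨z i, zmem hi⟩ := by
    intro i
    induction i with
    | zero => exact fun _ => .refl
    | succ i ih =>
      intro hi
      refine ((ih (by omega)).tail
        (st (z i) (z (i + 1)) _ (zmem (by omega)) (zzmem hi) (zmem hi) (mul_comm _ _))).tail
        (symR _ _ (st _ (z i) _ _ _ (zmem (by omega)) rfl))
  have all : ∀ s, Relation.ReflTransGen R ⟨z 0, zmem (by omega)⟩ s := by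
    rintro ⟨s, hs⟩
    rcases hs with ⟨i, hi, rfl⟩ | ⟨i, hi, rfl⟩ | rfl
    · exact key i hi
    · exact (key i (by omega)).tail (st _ (z (i + 1)) _ _ _ (zmem hi) (mul_comm _ _))
    · exact (key 1 (by omega)).tail (st _ (z 0 * z 1) _ _ _ (zzmem (by omega)) (by ac_rfl))
  intro u v
  exact (sym _ _ (all u)).trans (all v)

theorem drr_of_rigid [Finite A] {S : Set A} (hg : Subgroup.closure S = ⊤)
    (hr : InducedAutTrivial S S) : IsCayleyDRR S := by
  -- an automorphism fixing `x` fixes all its out-neighbours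
  have step : ∀ φ : Equiv.Perm A, IsCayleyAut S φ → φ 1 = 1 → ∀ s ∈ S, φ s = s := by
    intro φ hφ h1 s hs
    have hS : ∀ a, a ∈ S ↔ φ a ∈ S := fun a => by simpa [h1] using hφ 1 a
    have := hr (φ.subtypePerm (fun a => (hS a).symm)) (fun a b => hφ a b)
    have := congrArg (fun e : Equiv.Perm S => ((e ⟨s, hs⟩ : S) : A)) this
    simpa using this
  have step2 : ∀ φ : Equiv.Perm A, IsCayleyAut S φ → ∀ x, φ x = x → ∀ s ∈ S, φ (s * x) = s * x := by
    intro φ hφ x hx s hs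
    have := step ((Equiv.mulRight x).trans (φ.trans (Equiv.mulRight x⁻¹)))
      (fun a b => by
        have := hφ (a * x) (b * x)
        simpa [mul_assoc] using this) (by simp [hx]) s hs
    simp at this
    rw [mul_inv_eq_iff_eq_mul] at this
    exact this
  intro φ hφ
  refine ⟨φ 1, fun v => ?_⟩
  have h2 : IsCayleyAut S (φ.trans (Equiv.mulRight (φ 1)⁻¹)) := fun a b => by
    have := hφ a b
    simpa [mul_assoc] using this
  have hv : v ∈ Submonoid.closure S := by
    have : v ∈ (Subgroup.closure S).toSubmonoid := by rw [hg]; trivial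
    rwa [Subgroup.closure_toSubmonoid_of_finite] at this
  have : (φ.trans (Equiv.mulRight (φ 1)⁻¹)) v = v := by
    induction hv using Submonoid.closure_induction_left with
    | one => simp
    | mul_left s hs y hy ih => exact step2 _ h2 _ ih s hs
  simp at this
  rw [mul_inv_eq_iff_eq_mul] at this
  exact this

theorem IsChain2.final [Finite A] (h : IsChain2 n z p)
    (hg : Subgroup.closure (chainSet n z) = ⊤) :
    ∃ S : Set A, Subgroup.closure S = ⊤ ∧ 2 ≤ S.ncard ∧ S ∩ S⁻¹ = ∅ ∧
      InducedWeaklyConnected S S ∧ InducedAutTrivial S S ∧ IsCayleyDRR S := by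
  have hn := h.hn
  refine ⟨chainSet n z, hg, ?_, h.disj, h.conn, h.rigid, drr_of_rigid hg h.rigid⟩
  have : 1 < (chainSet n z).ncard := by
    rw [Set.one_lt_ncard (Set.toFinite _)]
    exact ⟨z 0, zmem (by omega), z 1, zmem (by omega), fun e => by
      have := h.z_inj (by omega) (by omega) e
      omega⟩
  omega

end Core

section Existence

variable {A : Type*} [CommGroup A]

theorem exists_quot (A : Type*) [CommGroup A] [Finite A] :
    ∃ (N : AddSubgroup (Additive A)) (_ : Module (ZMod 2) (Additive A ⧸ N)),
      ∀ a : Additive A, a ∈ N ↔ ∃ b, a = b + b := by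
  let N : AddSubgroup (Additive A) := (nsmulAddMonoidHom (α := Additive A) 2).range
  have hN : ∀ a : Additive A, a ∈ N ↔ ∃ b, a = b + b := by
    intro a
    simp only [N, AddMonoidHom.mem_range, nsmulAddMonoidHom_apply, two_nsmul]
    exact ⟨fun ⟨b, h⟩ => ⟨b, h.symm⟩, fun ⟨b, h⟩ => ⟨b, h.symm⟩⟩
  refine ⟨N, AddCommGroup.zmodModule (n := 2) ?_, hN⟩
  intro q
  obtain ⟨a, rfl⟩ := QuotientAddGroup.mk_surjective q
  rw [← QuotientAddGroup.mk_nsmul, QuotientAddGroup.eq_zero_iff, hN]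
  exact ⟨a, two_nsmul a⟩

variable {Q : Type*} [AddCommGroup Q] [Module (ZMod 2) Q] [Finite Q]

/-- The chain conditions for a tuple of length `n`. -/
def ChainTuple (π : A → Q) (x y : A) (n : ℕ) (z : ℕ → A) : Prop :=
  2 ≤ n ∧ z 0 = x ∧ z 1 = y ∧ (∀ i, i < n → z i * z i ≠ 1) ∧
    (∀ i, i + 1 < n → (z i * z (i + 1)) * (z i * z (i + 1)) ≠ 1) ∧
    LinearIndependent (ZMod 2) (fun i : Fin n => π (z i))

theorem exists_chain (π : A → Q) (hm : ∀ a b, π (a * b) = π a + π b)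
    (hs : Function.Surjective π) {x y : A}
    (li : LinearIndependent (ZMod 2) ![π x, π y]) (hx : x * x ≠ 1) (hy : y * y ≠ 1)
    (hxy : (x * y) * (x * y) ≠ 1) :
    ∃ n z, ChainTuple π x y n z ∧
      Submodule.span (ZMod 2) (Set.range (fun i : Fin n => π (z i))) = ⊤ := by
  have base : ∃ z, ChainTuple π x y 2 z := by
    refine ⟨fun i => if i = 0 then x else y, le_rfl, rfl, rfl, ?_, ?_, ?_⟩
    · intro i hi; dsimp only; split_ifs <;> assumption
    · intro i hi
      obtain rfl : i = 0 := by omega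
      simpa using hxy
    · convert li using 1
      ext i; fin_cases i <;> simp
  obtain ⟨n, ⟨z, hz⟩, hmax⟩ : ∃ n, (∃ z, ChainTuple π x y n z) ∧
      ¬ ∃ z, ChainTuple π x y (n + 1) z := by
    by_contra hcon
    push Not at hcon
    have all : ∀ n, ∃ z, ChainTuple π x y (n + 2) z := by
      intro n
      induction n with
      | zero => exact base
      | succ n ih =>
        obtain ⟨z, hz⟩ := ih
        exact hcon _ ⟨z, hz⟩
    obtain ⟨z, hz⟩ := all (Module.finrank (ZMod 2) Q)
    have := hz.2.2.2.2.2.fintype_card_le_finrank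
    simp at this
  refine ⟨n, z, hz, ?_⟩
  by_contra hspan
  obtain ⟨hn, h0, h1, hsq, hsq2, hli⟩ := hz
  set W := Submodule.span (ZMod 2) (Set.range (fun i : Fin n => π (z i))) with hW
  obtain ⟨v, hv⟩ : ∃ v, v ∉ W := by
    by_contra hc
    push Not at hc
    exact hspan (eq_top_iff.2 fun v _ => hc v)
  obtain ⟨e, rfl⟩ := hs v
  have hzW : ∀ i, i < n → π (z i) ∈ W := fun i hi => Submodule.subset_span ⟨⟨i, hi⟩, rfl⟩
  have hxW : π x ∈ W := h0 ▸ hzW 0 (by omega)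
  have hyW : π y ∈ W := h1 ▸ hzW 1 (by omega)
  obtain ⟨c, hc1, hc2⟩ : ∃ c, π c ∉ W ∧ c * c ≠ 1 ∧ (z (n - 1) * c) * (z (n - 1) * c) ≠ 1 := by
    by_contra hcon
    push Not at hcon
    have a0 := hcon e hv
    have a1 := hcon (e * x) (by rw [hm]; rwa [Submodule.add_mem_iff_left _ hxW])
    have a2 := hcon (e * (x * y)) (by
      rw [hm, hm]; rwa [Submodule.add_mem_iff_left _ (W.add_mem hxW hyW)])
    clear hcon
    set w := z (n - 1)
    have b1 : e * x * (e * x) = (e * e) * (x * x) := by ac_rfl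
    have b2 : e * (x * y) * (e * (x * y)) = (e * e) * ((x * y) * (x * y)) := by ac_rfl
    have b3 : w * e * (w * e) = (w * w) * (e * e) := by ac_rfl
    have b4 : w * (e * x) * (w * (e * x)) = (w * w) * ((e * e) * (x * x)) := by ac_rfl
    have b5 : w * (e * (x * y)) * (w * (e * (x * y))) =
      (w * w) * ((e * e) * ((x * y) * (x * y))) := by ac_rfl
    rw [b1, b4] at a1
    rw [b2, b5] at a2
    rw [b3] at a0
    have hne : (x * x) ≠ (x * y) * (x * y) := by
      intro h
      apply hy
      have : (x * y) * (x * y) = (x * x) * (y * y) := by ac_rfl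
      rw [this] at h
      simpa using h
    generalize e * e = E at *
    generalize w * w = F at *
    generalize (x * y) * (x * y) = Z at *
    generalize x * x = X at *
    by_cases c0 : E = 1
    · subst c0
      simp only [one_mul] at a1 a2
      have := a1 hx
      have := a2 hxy
      grind
    · have d0 := a0 c0
      by_cases c1 : E * X = 1
      · have c2 : E * Z ≠ 1 := fun h => hne (mul_left_cancel (c1.trans h.symm))
        have d2 := a2 c2
        have := mul_left_cancel (d0.trans d2.symm)
        exact hxy (by simpa using this)
      · have d1 := a1 c1
        have := mul_left_cancel (d0.trans d1.symm)
        exact hx (by simpa using this)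
  obtain ⟨hc2, hc3⟩ := hc2
  have hu : ∀ i, i < n → Function.update z n c i = z i := fun i hi =>
    Function.update_of_ne (by omega) _ _
  refine hmax ⟨Function.update z n c, by omega, ?_, ?_, ?_, ?_, ?_⟩
  · rw [hu _ (by omega), h0]
  · rw [hu _ (by omega), h1]
  · intro i hi
    rcases Nat.lt_succ_iff_lt_or_eq.1 hi with hi | rfl
    · rw [hu i hi]; exact hsq i hi
    · simpa using hc2
  · intro i hi
    rcases Nat.lt_succ_iff_lt_or_eq.1 hi with hi | hi
    · rw [hu i (by omega), hu _ hi]; exact hsq2 i hi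
    · subst hi
      rw [hu i (by omega)]
      simpa using hc3
  · have := (linearIndependent_finSnoc (K := ZMod 2) (v := fun i : Fin n => π (z i)) (x := π c)).2
      ⟨hli, hc1⟩
    convert this using 1
    ext i
    refine Fin.lastCases ?_ (fun j => ?_) i
    · simp
    · simp [hu j j.2]

theorem gen_of_span [Finite A] {k : ℕ} (hk : Nat.card A = 2 ^ k) (π : A → Q)
    (hm : ∀ a b, π (a * b) = π a + π b) (hker : ∀ a, π a = 0 → ∃ b, a = b * b)
    (T : Set A) (hT : Submodule.span (ZMod 2) (π '' T) = ⊤) : Subgroup.closure T = ⊤ := by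
  set H := Subgroup.closure T
  have h1 : π 1 = 0 := by
    have := hm 1 1
    simpa using this
  have hinv : ∀ a, π a⁻¹ = - π a := fun a => by
    have := hm a⁻¹ a
    rw [inv_mul_cancel, h1] at this
    exact eq_neg_of_add_eq_zero_left this.symm
  have step : ∀ a, ∃ h ∈ H, ∃ b, a = h * (b * b) := by
    intro a
    have : ∀ q ∈ Submodule.span (ZMod 2) (π '' T), ∃ h ∈ H, π h = q := by
      intro q hq
      induction hq using Submodule.span_induction with
      | mem q hq =>
        obtain ⟨t, ht, rfl⟩ := hq
        exact ⟨t, Subgroup.subset_closure ht, rfl⟩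
      | zero => exact ⟨1, H.one_mem, h1⟩
      | add q r _ _ hq hr =>
        obtain ⟨a, ha, rfl⟩ := hq
        obtain ⟨b, hb, rfl⟩ := hr
        exact ⟨a * b, H.mul_mem ha hb, hm a b⟩
      | smul c q _ hq =>
        obtain ⟨a, ha, rfl⟩ := hq
        have : c = 0 ∨ c = 1 := by revert c; decide
        rcases this with rfl | rfl
        · exact ⟨1, H.one_mem, by rw [h1, zero_smul]⟩
        · exact ⟨a, ha, by rw [one_smul]⟩
    obtain ⟨h, hh, he⟩ := this (π a) (by rw [hT]; trivial)
    obtain ⟨b, hb⟩ := hker (h⁻¹ * a) (by rw [hm, hinv, he]; simp)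
    exact ⟨h, hh, b, by rw [← hb]; simp⟩
  have iter : ∀ m, ∀ a, ∃ h ∈ H, ∃ b, a = h * b ^ (2 ^ m) := by
    intro m
    induction m with
    | zero => exact fun a => ⟨1, H.one_mem, a, by simp⟩
    | succ m ih =>
      intro a
      obtain ⟨h, hh, b, rfl⟩ := ih a
      obtain ⟨h', hh', b', rfl⟩ := step b
      refine ⟨h * h' ^ (2 ^ m), H.mul_mem hh (H.pow_mem hh' _), b', ?_⟩
      rw [mul_pow, ← mul_assoc, ← pow_two, ← pow_mul, pow_succ' 2 m]
  rw [eq_top_iff]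
  intro a _
  obtain ⟨h, hh, b, rfl⟩ := iter k a
  have : b ^ (2 ^ k) = 1 := by rw [← hk]; exact pow_card_eq_one'
  rw [this, mul_one]
  exact hh

/-- The case where `A` is not cyclic. -/
theorem noncyclic_case [Finite A] {k : ℕ} (hk : Nat.card A = 2 ^ k) (π : A → Q)
    (hm : ∀ a b, π (a * b) = π a + π b) (hs : Function.Surjective π)
    (hker : ∀ a, π a = 0 → ∃ b, a = b * b) {x y : A}
    (li : LinearIndependent (ZMod 2) ![π x, π y]) (hx : x * x ≠ 1) (hy : y * y ≠ 1)
    (hxy : (x * y) * (x * y) ≠ 1) (hu : (x * (y * y)) * (x * (y * y)) ≠ 1) :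
    ∃ S : Set A, Subgroup.closure S = ⊤ ∧ 2 ≤ S.ncard ∧ S ∩ S⁻¹ = ∅ ∧
      InducedWeaklyConnected S S ∧ InducedAutTrivial S S ∧ IsCayleyDRR S := by
  obtain ⟨n, z, ⟨hn, h0, h1, hsq, hsq2, hli⟩, hspan⟩ := exists_chain π hm hs li hx hy hxy
  let B := Module.Basis.mk hli hspan.ge
  have hB : ∀ i : Fin n, B i = π (z i) := fun i => by simp [B]
  have hc : IsChain2 n z (fun a l => ∃ h : l < n, B.repr (π a) ⟨l, h⟩ ≠ 0) := by
    refine ⟨hn, hsq, hsq2, by rw [h0, h1]; exact hu, ?_, ?_⟩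
    · intro a b l
      by_cases hl : l < n
      · simp only [hl, exists_true_left, hm, map_add, Finsupp.add_apply]
        generalize (B.repr (π a)) ⟨l, hl⟩ = c
        generalize (B.repr (π b)) ⟨l, hl⟩ = d
        revert c d; decide
      · simp [hl]
    · intro i l hi
      have : π (z i) = B ⟨i, hi⟩ := (hB ⟨i, hi⟩).symm
      simp only [this, Module.Basis.repr_self, Finsupp.single_apply, Fin.mk.injEq]
      constructor
      · rintro ⟨h, h'⟩
        by_contra hne
        rw [if_neg (fun h => hne h.symm)] at h'
        exact h' rfl
      · rintro rfl
        exact ⟨hi, by simp⟩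
  apply hc.final
  apply gen_of_span hk π hm hker
  rw [eq_top_iff, ← hspan]
  apply Submodule.span_mono
  rintro _ ⟨i, rfl⟩
  exact ⟨z i, zmem i.2, rfl⟩

theorem cyclic_case [Finite A] {x : A} (hx : Subgroup.closure {x} = ⊤) (h4 : x ^ 4 ≠ 1)
    (h3 : x ^ 3 ≠ 1) :
    ∃ S : Set A, Subgroup.closure S = ⊤ ∧ 2 ≤ S.ncard ∧ S ∩ S⁻¹ = ∅ ∧
      InducedWeaklyConnected S S ∧ InducedAutTrivial S S ∧ IsCayleyDRR S := by
  have h2 : x ^ 2 ≠ 1 := fun h => h4 (by rw [show 4 = 2 * 2 from rfl, pow_mul, h, one_pow])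
  have h1 : x ≠ 1 := fun h => h2 (by rw [h, one_pow])
  have hne : x ≠ x ^ 2 := fun h => h1 (by simpa [pow_two] using h)
  have hg : Subgroup.closure {x, x ^ 2} = ⊤ := by
    rw [eq_top_iff, ← hx]
    exact Subgroup.closure_mono (by simp)
  have hr : InducedAutTrivial ({x, x ^ 2} : Set A) {x, x ^ 2} := by
    intro ψ hψ
    have e := (hψ ⟨x, by simp⟩ ⟨x ^ 2, by simp⟩).1 (by left; simp [pow_two])
    have hx1 : (ψ ⟨x, by simp⟩ : A) = x := by
      rcases (ψ ⟨x, by simp⟩).2 with h | h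
      · exact h
      · exfalso
        have h' : (ψ ⟨x, by simp⟩ : A) = x ^ 2 := h
        rcases (ψ ⟨x ^ 2, by simp⟩).2 with h'' | h''
        · have h3' : (ψ ⟨x ^ 2, by simp⟩ : A) = x := h''
          rw [h', h3'] at e
          rcases e with e | e
          · rw [mul_inv_eq_iff_eq_mul] at e
            exact h2 (by simpa using e)
          · have e : x * (x ^ 2)⁻¹ = x ^ 2 := e
            rw [mul_inv_eq_iff_eq_mul] at e
            apply h3
            have : x * x ^ 3 = x * 1 := by rw [mul_one]; nth_rw 3 [e]; group
            exact mul_left_cancel this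
        · have h3' : (ψ ⟨x ^ 2, by simp⟩ : A) = x ^ 2 := h''
          have := ψ.injective (Subtype.ext (h'.trans h3'.symm))
          exact hne (congrArg Subtype.val this)
    have hx2 : (ψ ⟨x ^ 2, by simp⟩ : A) = x ^ 2 := by
      rcases (ψ ⟨x ^ 2, by simp⟩).2 with h | h
      · have h' : (ψ ⟨x ^ 2, by simp⟩ : A) = x := h
        have := ψ.injective (Subtype.ext (h'.trans hx1.symm))
        exact (hne (congrArg Subtype.val this).symm).elim
      · exact h
    ext ⟨s, hs⟩
    rcases hs with rfl | hs
    · exact hx1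
    · have : s = x ^ 2 := hs
      subst this
      exact hx2
  refine ⟨{x, x ^ 2}, hg, ?_, ?_, ?_, hr, drr_of_rigid hg hr⟩
  · rw [Set.ncard_pair hne]
  · ext s
    simp only [Set.mem_inter_iff, Set.mem_inv, Set.mem_insert_iff, Set.mem_singleton_iff,
      Set.mem_empty_iff_false, iff_false, not_and]
    rintro (rfl | rfl) (h | h) <;> rw [inv_eq_iff_mul_eq_one] at h
    · exact h2 (by rw [← h, pow_two])
    · exact h3 (by rw [← h]; group)
    · exact h3 (by rw [← h]; group)
    · exact h4 (by rw [← h]; group)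
  · have key : ∀ (h : x ∈ ({x, x ^ 2} : Set A)) (h' : x ^ 2 ∈ ({x, x ^ 2} : Set A)),
        (x ^ 2) * x⁻¹ ∈ ({x, x ^ 2} : Set A) := by
      intro _ _; left; simp [pow_two]
    have k := key (by simp) (by simp)
    rintro ⟨u, hu⟩ ⟨v, hv⟩
    rcases hu with rfl | hu
    · rcases hv with rfl | hv
      · exact .refl
      · have hv : v = u ^ 2 := hv
        subst hv
        exact .single (Or.inl k)
    · have hu : u = x ^ 2 := hu
      subst hu
      rcases hv with rfl | hv
      · exact .single (Or.inr k)
      · have hv : v = x ^ 2 := hv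
        subst hv
        exact .refl

end Existence

section Final

theorem pair_li {Q : Type*} [AddCommGroup Q] [Module (ZMod 2) Q] {a b : Q} (ha : a ≠ 0)
    (hb : b ≠ 0) (hab : a + b ≠ 0) : LinearIndependent (ZMod 2) ![a, b] := by
  rw [LinearIndependent.pair_iff]
  intro s t hst
  have h01 : ∀ c : ZMod 2, c = 0 ∨ c = 1 := by decide
  rcases h01 s with rfl | rfl <;> rcases h01 t with rfl | rfl
  · exact ⟨rfl, rfl⟩
  · exact (hb (by simpa using hst)).elim
  · exact (ha (by simpa using hst)).elim
  · rw [one_smul, one_smul] at hst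
    exact (hab hst).elim

variable {A : Type*} [CommGroup A]

theorem c4_iso [Finite A] {k : ℕ} (hk : Nat.card A = 2 ^ k) {x : A} (hx : x * x ≠ 1)
    (hx4 : x ^ 4 = 1) (hW : ∀ a : A, a * a = 1 ∨ a * a = x * x) :
    Nonempty (A ≃* Multiplicative (ZMod 4 × (Fin (k - 2) → ZMod 2))) := by
  let N : AddSubgroup (Additive A) := (nsmulAddMonoidHom (α := Additive A) 2).ker
  have hN : ∀ a : Additive A, a ∈ N ↔ a + a = 0 := by
    intro a
    simp only [N, AddMonoidHom.mem_ker, nsmulAddMonoidHom_apply, two_nsmul]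
  let _ : Module (ZMod 2) N := AddCommGroup.zmodModule (n := 2) (by
    rintro ⟨a, ha⟩
    rw [two_nsmul]
    exact Subtype.ext ((hN a).1 ha))
  let X : Additive A := Additive.ofMul x
  have hX : X + X ≠ 0 := hx
  have hX4 : (X + X) + (X + X) = 0 := by
    have : x * x * (x * x) = 1 := by rw [← hx4, ← pow_two, ← pow_two, ← pow_mul]
    exact this
  have hW' : ∀ a : Additive A, a + a = 0 ∨ a + a = X + X := fun a => hW a.toMul
  let w : N := ⟨X + X, (hN _).2 hX4⟩
  obtain ⟨K, hK⟩ := Submodule.exists_isCompl (Submodule.span (ZMod 2) {w})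
  have hwK : w ∉ K := by
    intro h
    have : w ∈ Submodule.span (ZMod 2) {w} ⊓ K := ⟨Submodule.mem_span_singleton_self w, h⟩
    rw [hK.inf_eq_bot, Submodule.mem_bot] at this
    exact hX (congrArg Subtype.val this)
  have hdec : ∀ v : N, v ∈ K ∨ ∃ u ∈ K, v = w + u := by
    intro v
    have : v ∈ Submodule.span (ZMod 2) {w} ⊔ K := by rw [hK.sup_eq_top]; trivial
    obtain ⟨a, ha, u, hu, rfl⟩ := Submodule.mem_sup.1 this
    obtain ⟨c, rfl⟩ := Submodule.mem_span_singleton.1 ha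
    have : c = 0 ∨ c = 1 := (by decide : ∀ c : ZMod 2, c = 0 ∨ c = 1) c
    rcases this with rfl | rfl
    · left; simpa using hu
    · right; exact ⟨u, hu, by simp⟩
  let g : ZMod 4 →+ Additive A := ZMod.lift 4 ⟨zmultiplesHom _ X, by
    simp only [zmultiplesHom_apply]
    rw [← hX4]
    abel⟩
  have g1 : g 1 = X := by
    have := ZMod.lift_coe 4 ⟨zmultiplesHom (Additive A) X, by
      simp only [zmultiplesHom_apply]
      rw [← hX4]
      abel⟩ 1
    simpa [g] using this
  have g2 : g 2 = X + X := by rw [show (2 : ZMod 4) = 1 + 1 from rfl, map_add, g1]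
  have g3 : g 3 = X + X + X := by rw [show (3 : ZMod 4) = 2 + 1 from rfl, map_add, g1, g2]
  let f : ZMod 4 × K →+ Additive A := AddMonoidHom.coprod g (N.subtype.comp K.subtype.toAddMonoidHom)
  have hf : ∀ j u, f (j, u) = g j + ((u : N) : Additive A) := fun j u => rfl
  have finj : Function.Injective f := by
    rw [injective_iff_map_eq_zero]
    rintro ⟨j, u⟩ h
    rw [hf] at h
    have hu2 := (hN _).1 (u : N).2
    have hj : j = 0 ∨ j = 1 ∨ j = 2 ∨ j = 3 :=
      (by decide : ∀ j : ZMod 4, j = 0 ∨ j = 1 ∨ j = 2 ∨ j = 3) j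
    have hsum : g j + g j = 0 := by
      have : (g j + ((u : N) : Additive A)) + (g j + ((u : N) : Additive A)) = 0 := by
        rw [h, add_zero]
      rw [← this, add_add_add_comm, hu2, add_zero]
    rcases hj with rfl | rfl | rfl | rfl
    · rw [map_zero, zero_add] at h
      have : u = 0 := Subtype.ext (Subtype.ext h)
      rw [this]; rfl
    · rw [g1] at hsum; exact (hX hsum).elim
    · exfalso
      apply hwK
      rw [g2] at h
      have : w + (u : N) = 0 := Subtype.ext h
      rw [eq_neg_of_add_eq_zero_left this]
      exact K.neg_mem u.2
    · exfalso
      apply hX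
      rw [g3] at hsum
      have e : X + X + X + (X + X + X) = (X + X) + (X + X + (X + X)) := by abel
      rwa [e, hX4, add_zero] at hsum
  have hNdec : ∀ v ∈ N, ∃ p, f p = v := by
    intro v hv
    rcases hdec ⟨v, hv⟩ with h | ⟨u, hu, h⟩
    · exact ⟨(0, ⟨⟨v, hv⟩, h⟩), by rw [hf]; simp⟩
    · refine ⟨(2, ⟨u, hu⟩), ?_⟩
      rw [hf, g2]
      exact (congrArg Subtype.val h).symm
  have fsurj : Function.Surjective f := by
    intro a
    rcases hW' a with h | h
    · exact hNdec a ((hN a).2 h)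
    · obtain ⟨q, hq⟩ := hNdec (a - X) ((hN _).2 (by
        rw [sub_add_sub_comm, h, sub_self]))
      refine ⟨q + (1, 0), ?_⟩
      rw [map_add, hq, hf, g1]
      simp
  let F : ZMod 4 × K ≃+ Additive A := AddEquiv.ofBijective f ⟨finj, fsurj⟩
  have hcard : 4 * 2 ^ (Module.finrank (ZMod 2) K) = 2 ^ k := by
    rw [← hk, ← Nat.card_congr (Additive.ofMul (α := A)).symm, ← Nat.card_congr F.toEquiv,
      Nat.card_prod, Nat.card_zmod, Module.natCard_eq_pow_finrank (K := ZMod 2) (V := K),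
      Nat.card_zmod]
  have hd : Module.finrank (ZMod 2) K = k - 2 := by
    have : 2 ^ (Module.finrank (ZMod 2) K + 2) = 2 ^ k := by rw [← hcard]; ring
    have := Nat.pow_right_injective le_rfl this
    omega
  let E : K ≃ₗ[ZMod 2] (Fin (k - 2) → ZMod 2) := (Module.finBasisOfFinrankEq (ZMod 2) K hd).equivFun
  let G : Additive A ≃+ ZMod 4 × (Fin (k - 2) → ZMod 2) :=
    F.symm.trans (AddEquiv.prodCongr (AddEquiv.refl _) E.toAddEquiv)
  exact ⟨AddEquiv.toMultiplicativeRight G⟩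

theorem exists_max (A : Type*) [CommGroup A] [Finite A] {k : ℕ} (hk : Nat.card A = 2 ^ k)
    (hne : ¬ ∀ a : A, a ^ 2 = 1) :
    ∃ m, ∃ x : A, (∀ a : A, a ^ (2 ^ (m + 2)) = 1) ∧ x ^ (2 ^ (m + 1)) ≠ 1 := by
  classical
  have hex : ∃ M, ∀ a : A, a ^ (2 ^ M) = 1 := ⟨k, fun a => by rw [← hk]; exact pow_card_eq_one'⟩
  obtain ⟨M, hM, hmin⟩ : ∃ M, (∀ a : A, a ^ (2 ^ M) = 1) ∧
      ∀ j < M, ¬ ∀ a : A, a ^ (2 ^ j) = 1 :=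
    ⟨Nat.find hex, Nat.find_spec hex, fun j hj => Nat.find_min hex hj⟩
  rcases M with _ | _ | m
  · exact (hne fun a => by have := hM a; simp at this; simp [this]).elim
  · exact (hne fun a => by simpa using hM a).elim
  · have := hmin (m + 1) (by omega)
    push Not at this
    obtain ⟨x, hx⟩ := this
    exact ⟨m, x, hM, hx⟩

end Final

/-- Let `A` be an abelian 2-group of order `2^k` which is neither elementary abelian
nor isomorphic to `C₄ × C₂^{k-2}`. Then `A` has a generating set `S` with `|S| ≥ 2`
and `S ∩ S⁻¹ = ∅` such that the subdigraph of `Cay(A,S)` induced on `S` is weakly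
connected with trivial automorphism group, and `Cay(A,S)` is an ORR of `A`. -/
theorem abelian_two_group_ORR {A : Type*} [CommGroup A] (k : ℕ)
    (hcard : Nat.card A = 2 ^ k)
    (hnotelem : ¬ ∀ a : A, a ^ 2 = 1)
    (hnotC4 : ¬ Nonempty (A ≃* Multiplicative (ZMod 4 × (Fin (k - 2) → ZMod 2)))) :
    ∃ S : Set A, Subgroup.closure S = ⊤ ∧ 2 ≤ S.ncard ∧ S ∩ S⁻¹ = ∅ ∧
      InducedWeaklyConnected S S ∧ InducedAutTrivial S S ∧ IsCayleyDRR S := by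
  have : Finite A := Nat.finite_of_card_ne_zero (by rw [hcard]; positivity)
  obtain ⟨m, x, hM, hxm⟩ := exists_max A hcard hnotelem
  obtain ⟨N, inst, hN⟩ := exists_quot A
  let π : A → Additive A ⧸ N := fun a => QuotientAddGroup.mk (Additive.ofMul a)
  have hm : ∀ a b, π (a * b) = π a + π b := fun a b => rfl
  have hs : Function.Surjective π := fun q => by
    obtain ⟨a, rfl⟩ := QuotientAddGroup.mk_surjective q
    exact ⟨a.toMul, rfl⟩
  have hker : ∀ a, π a = 0 → ∃ b, a = b * b := fun a ha =>
    (hN _).1 ((QuotientAddGroup.eq_zero_iff _).1 ha)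
  have hdbl : ∀ a, π a + π a = 0 := fun a => by
    rw [← hm]
    exact (QuotientAddGroup.eq_zero_iff _).2 ((hN _).2 ⟨Additive.ofMul a, rfl⟩)
  have hxx : x * x ≠ 1 := fun h => hxm (by
    rw [pow_succ', pow_mul, pow_two, h, one_pow])
  have hpx : π x ≠ 0 := fun h => by
    obtain ⟨b, rfl⟩ := hker x h
    apply hxm
    rw [← pow_two, ← pow_mul, ← pow_succ']
    exact hM b
  have hu : ∀ y : A, (x * (y * y)) * (x * (y * y)) ≠ 1 := fun y h => by
    apply hxm
    have h1 : x ^ 2 * y ^ 4 = 1 := by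
      rw [← h, pow_two, show 4 = 2 * 2 from rfl, pow_mul, pow_two, pow_two]; ac_rfl
    have h2 : (x ^ 2 * y ^ 4) ^ (2 ^ m) = 1 := by rw [h1, one_pow]
    rw [mul_pow, ← pow_mul, ← pow_mul, show 4 * 2 ^ m = 2 ^ (m + 2) by ring, hM, mul_one,
      ← pow_succ'] at h2
    exact h2
  have main : ∀ y : A, π y ≠ 0 → π y ≠ π x → y * y ≠ 1 → (x * y) * (x * y) ≠ 1 →
      ∃ S : Set A, Subgroup.closure S = ⊤ ∧ 2 ≤ S.ncard ∧ S ∩ S⁻¹ = ∅ ∧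
      InducedWeaklyConnected S S ∧ InducedAutTrivial S S ∧ IsCayleyDRR S := by
    intro y h1 h2 h3 h4
    refine noncyclic_case hcard π hm hs hker (x := x) (y := y) ?_ hxx h3 h4 (hu y)
    exact pair_li hpx h1 fun hst => h2 (add_left_cancel (hst.trans (hdbl x).symm))
  by_cases hx4 : x ^ 4 = 1
  · have hm0 : m = 0 := by
      by_contra hne
      obtain ⟨j, rfl⟩ : ∃ j, m = j + 1 := ⟨m - 1, by omega⟩
      apply hxm
      rw [show 2 ^ (j + 1 + 1) = 4 * 2 ^ j by ring, pow_mul, hx4, one_pow]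
    subst hm0
    have h4 : ∀ a : A, a * a * (a * a) = 1 := fun a => by
      rw [← hM a, ← pow_two, ← pow_two, ← pow_mul]; rfl
    have hxi : ∀ b : A, x * x * b = 1 → b = x * x := fun b hb =>
      mul_left_cancel (hb.trans (h4 x).symm)
    by_cases hW : ∀ a : A, a * a = 1 ∨ a * a = x * x
    · exact (hnotC4 (c4_iso hcard hxx hx4 hW)).elim
    · push Not at hW
      obtain ⟨y, hy1, hy2⟩ := hW
      have hxy : (x * y) * (x * y) ≠ 1 := fun h => hy2 (hxi _ (by rw [← h]; ac_rfl))
      refine main y ?_ ?_ hy1 hxy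
      · intro h
        obtain ⟨b, rfl⟩ := hker y h
        exact hy1 (h4 b)
      · intro h
        obtain ⟨b, hb⟩ := hker (x * y) (by rw [hm, h, hdbl])
        exact hxy (by rw [hb]; exact h4 b)
  · have hx4' : (x * x) * (x * x) ≠ 1 := fun h => hx4 (by rw [← h, ← pow_two, ← pow_two, ← pow_mul])
    by_cases hc : ∀ y, π y = 0 ∨ π y = π x
    · refine cyclic_case (x := x) ?_ hx4 ?_
      · apply gen_of_span hcard π hm hker
        rw [eq_top_iff]
        intro q _
        obtain ⟨y, rfl⟩ := hs q
        rcases hc y with h | h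
        · rw [h]; exact Submodule.zero_mem _
        · rw [h]; exact Submodule.subset_span ⟨x, rfl, rfl⟩
      · intro h3
        have h1 : orderOf x ∣ 3 := orderOf_dvd_of_pow_eq_one h3
        have h2 : orderOf x ∣ 2 ^ (m + 2) := orderOf_dvd_of_pow_eq_one (hM x)
        have hco : Nat.Coprime 3 (2 ^ (m + 2)) := Nat.Coprime.pow_right _ (by norm_num)
        have := Nat.eq_one_of_dvd_coprimes hco h1 h2
        rw [orderOf_eq_one_iff] at this
        exact hxx (by rw [this, mul_one])
    · push Not at hc
      obtain ⟨y, hy0, hyx⟩ := hc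
      have hyx0 : π (y * x) ≠ 0 := by
        rw [hm]; intro h
        exact hyx (add_right_cancel (h.trans (hdbl x).symm))
      have hyxx : π (y * x) ≠ π x := by
        rw [hm]; intro h
        exact hy0 (by simpa using h)
      have hpxx : π (y * (x * x)) = π y := by rw [hm, hm, hdbl, add_zero]
      by_cases c1 : y * y = 1
      · apply main (y * x) hyx0 hyxx
        · rw [show y * x * (y * x) = (y * y) * (x * x) by ac_rfl, c1, one_mul]; exact hxx
        · rw [show x * (y * x) * (x * (y * x)) = (y * y) * ((x * x) * (x * x)) by ac_rfl, c1,
            one_mul]; exact hx4'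
      by_cases c2 : (x * y) * (x * y) = 1
      · apply main (y * (x * x)) (by rwa [hpxx]) (by rwa [hpxx])
        · rw [show y * (x * x) * (y * (x * x)) = (x * y) * (x * y) * (x * x) by ac_rfl, c2,
            one_mul]; exact hxx
        · rw [show x * (y * (x * x)) * (x * (y * (x * x))) =
            (x * y) * (x * y) * ((x * x) * (x * x)) by ac_rfl, c2, one_mul]; exact hx4'
      exact main y hy0 hyx c1 c2
end

section
/- Let G be a 2-group that is not generalised dihedral, and let N be a normal subgroup of G with G/N elementary abelian. Suppose there exists T ⊆ N with |T| ≥ 2 such that Cay(N,T) is an oriented regular representation of N and the subdigraph induced by Cay(N,T) on the neighbourhood T of the vertex 1 is weakly connected. Let κ := d(G/N) be the minimum number of generators of G/N. Then there is a set of elements {a_1,…,a_κ} ⊆ G∖N such that G = ⟨a_1,…,a_κ, N⟩ and the order of a_i is greater than 2 for each i ∈ {1,…,κ}. -/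
/-- `κ` is the minimum number of generators of the group `H`. -/
def IsMinGenCard (H : Type*) [Group H] (κ : ℕ) : Prop :=
  (∃ f : Fin κ → H, Subgroup.closure (Set.range f) = ⊤) ∧
  ∀ m : ℕ, (∃ f : Fin m → H, Subgroup.closure (Set.range f) = ⊤) → κ ≤ m

section Helpers

open Module

lemma span_eq_top_iff_closure {Q : Type*} [CommGroup Q] [Module (ZMod 2) (Additive Q)]
    (S : Set Q) :
    Submodule.span (ZMod 2) (Additive.toMul ⁻¹' S : Set (Additive Q)) = ⊤ ↔
      Subgroup.closure S = ⊤ := by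
  constructor
  · intro h
    have hle : Submodule.span (ZMod 2) (Additive.toMul ⁻¹' S : Set (Additive Q)) ≤
        AddSubgroup.toZModSubmodule 2 (Subgroup.toAddSubgroup (Subgroup.closure S)) := by
      rw [Submodule.span_le]
      intro x hx
      exact (Subgroup.subset_closure : S ⊆ _) hx
    rw [eq_top_iff]
    intro q _
    have : Additive.ofMul q ∈
        Submodule.span (ZMod 2) (Additive.toMul ⁻¹' S : Set (Additive Q)) := by
      rw [h]; trivial
    exact hle this
  · intro h
    rw [eq_top_iff]
    intro x _
    have hx : x.toMul ∈ Subgroup.closure S := by rw [h]; trivial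
    have key : ∀ q ∈ Subgroup.closure S, Additive.ofMul q ∈
        Submodule.span (ZMod 2) (Additive.toMul ⁻¹' S : Set (Additive Q)) := by
      intro q hq
      induction hq using Subgroup.closure_induction with
      | mem y hy => exact Submodule.subset_span hy
      | one => exact Submodule.zero_mem _
      | mul a b _ _ ha hb => exact Submodule.add_mem _ ha hb
      | inv a _ ha => exact Submodule.neg_mem _ ha
    exact key _ hx

/-- In a finite elementary abelian 2-group, any generating set contains a generating tuple
of minimal length. -/
lemma exists_min_gen_in {Q : Type*} [CommGroup Q] [Finite Q] (h2 : ∀ q : Q, q ^ 2 = 1)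
    (X : Set Q) (hX : Subgroup.closure X = ⊤) (κ : ℕ)
    (h1 : ∃ f : Fin κ → Q, Subgroup.closure (Set.range f) = ⊤)
    (hmin : ∀ m : ℕ, (∃ f : Fin m → Q, Subgroup.closure (Set.range f) = ⊤) → κ ≤ m) :
    ∃ b : Fin κ → Q, (∀ i, b i ∈ X) ∧ Subgroup.closure (Set.range b) = ⊤ := by
  let _ : Module (ZMod 2) (Additive Q) := AddCommGroup.zmodModule (n := 2) (fun x => h2 x.toMul)
  have : Finite (Additive Q) := ‹Finite Q›
  obtain ⟨b, hbX, hbs, -⟩ := Submodule.exists_fun_fin_finrank_span_eq (ZMod 2)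
    (Additive.toMul ⁻¹' X : Set (Additive Q))
  have hXs := (span_eq_top_iff_closure X).2 hX
  have hb : Subgroup.closure (Set.range (fun i => (b i).toMul)) = ⊤ := by
    rw [← span_eq_top_iff_closure]
    exact hbs.trans hXs
  have hle1 := hmin _ ⟨_, hb⟩
  obtain ⟨f, hf⟩ := h1
  have hle2 : finrank (ZMod 2)
      (Submodule.span (ZMod 2) (Additive.toMul ⁻¹' X : Set (Additive Q))) ≤ κ := by
    have h := finrank_range_le_card (R := ZMod 2) (fun i => Additive.ofMul (f i))
    have hs := (span_eq_top_iff_closure _).2 hf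
    rw [hXs, ← hs]
    rw [Set.finrank, Fintype.card_fin] at h
    exact h
  have heq := le_antisymm hle1 hle2
  refine ⟨fun i => (b (Fin.cast heq i)).toMul, fun i => hbX _, ?_⟩
  rw [← hb]
  congr 1
  ext q
  constructor
  · rintro ⟨i, rfl⟩
    exact ⟨_, rfl⟩
  · rintro ⟨i, rfl⟩
    exact ⟨Fin.cast heq.symm i, rfl⟩

lemma mul_self_of_not_two_lt {G : Type*} [Group G] [Finite G] {g : G}
    (h : ¬ 2 < orderOf g) : g * g = 1 := by
  have hpos := orderOf_pos g
  have hd : orderOf g ∣ 2 := by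
    have : orderOf g = 1 ∨ orderOf g = 2 := by omega
    rcases this with h | h <;> simp [h]
  rw [← pow_two]
  exact orderOf_dvd_iff_pow_eq_one.1 hd

/-- If every element outside the proper subgroup `H` is an involution, then `G` is generalised
dihedral or `H` has exponent dividing 2. -/
lemma gd_or_exponent_two {G : Type*} [Group G] (H : Subgroup G) (hH : H ≠ ⊤)
    (hinv : ∀ g, g ∉ H → g * g = 1) :
    IsGeneralizedDihedral G ∨ ∀ h ∈ H, h * h = 1 := by
  have hconj : ∀ t, t ∉ H → ∀ h ∈ H, t * h * t = h⁻¹ := by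
    intro t ht h hh
    have h1 : t * h ∉ H := fun hc => ht ((H.mul_mem_cancel_right hh).1 hc)
    have h2 := hinv _ h1
    rw [eq_inv_iff_mul_eq_one, ← h2]
    group
  obtain ⟨t, ht⟩ : ∃ t, t ∉ H := by
    by_contra! hc
    exact hH ((Subgroup.eq_top_iff' H).2 hc)
  have htt := hinv t ht
  by_cases hidx : ∀ s, s ∉ H → s * t ∈ H
  · left
    refine ⟨H, ?_, t, ht, htt, hconj t ht, ?_⟩
    · intro a ha b hb
      have e : (t * a * t) * (t * b * t) = t * (a * b) * t := by
        calc (t * a * t) * (t * b * t) = t * a * (t * t) * b * t := by group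
          _ = t * (a * b) * t := by rw [htt]; group
      rw [hconj t ht a ha, hconj t ht b hb, hconj t ht _ (H.mul_mem ha hb)] at e
      have := congrArg (·⁻¹) e
      simp only [mul_inv_rev, inv_inv] at this
      exact this.symm
    · intro g
      by_cases hg : g ∈ H
      · exact Or.inl hg
      · right
        exact ⟨g * t, hidx g hg, by rw [mul_assoc, htt, mul_one]⟩
  · right
    push Not at hidx
    obtain ⟨s, hs, hst⟩ := hidx
    intro h hh
    have hss := hinv s hs
    have h1 := hconj _ hst h hh
    have h2 := hinv _ hst
    have hcomm : s * t = t * s := by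
      calc s * t = s * t * (s * t) * (t⁻¹ * s⁻¹) := by group
        _ = t⁻¹ * s⁻¹ := by rw [h2, one_mul]
        _ = t * s := by rw [inv_eq_of_mul_eq_one_left htt, inv_eq_of_mul_eq_one_left hss]
    have h3 : s * t * h * (s * t) = h := by
      calc s * t * h * (s * t) = s * (t * h * t) * s := by
            nth_rewrite 2 [hcomm]; group
        _ = h := by rw [hconj t ht h hh, hconj s hs _ (H.inv_mem hh), inv_inv]
    rw [h3] at h1
    nth_rewrite 1 [h1]
    exact inv_mul_cancel h

end Helpers

/-- Let `G` be a 2-group that is not generalised dihedral and let `N` be a normal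
subgroup with `G/N` elementary abelian. Suppose `T ⊆ N` with `|T| ≥ 2` is such that
`Cay(N,T)` is an ORR of `N` whose induced subdigraph on `T` is weakly connected.
If `κ = d(G/N)`, then there exist `a 0, …, a (κ-1) ∈ G∖N` with
`G = ⟨a 0, …, a (κ-1), N⟩` and every `a i` of order greater than 2. -/
theorem exists_noninvolution_generators {G : Type*} [Group G] [Finite G]
    (hG : IsPGroup 2 G) (hngd : ¬ IsGeneralizedDihedral G)
    (N : Subgroup G) (hN : N.Normal) (hquot : ∀ q : G ⧸ N, q ^ 2 = 1)
    (T : Set N) (hT2 : 2 ≤ T.ncard)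
    (hTorient : T ∩ T⁻¹ = ∅) (hTorr : IsCayleyDRR T)
    (hTconn : InducedWeaklyConnected T T)
    (κ : ℕ) (hκ : IsMinGenCard (G ⧸ N) κ) :
    ∃ a : Fin κ → G, (∀ i, a i ∉ N) ∧
      Subgroup.closure (Set.range a ∪ (N : Set G)) = ⊤ ∧
      ∀ i, 2 < orderOf (a i) := by
  have := hN
  set X : Set G := {g | g ∉ N ∧ 2 < orderOf g} with hXdef
  set H : Subgroup G := Subgroup.closure (X ∪ (N : Set G)) with hHdef
  have hNH : N ≤ H := fun n hn => Subgroup.subset_closure (Or.inr hn)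
  have hHtop : H = ⊤ := by
    by_contra hne
    have hinv : ∀ g, g ∉ H → g * g = 1 := by
      intro g hg
      apply mul_self_of_not_two_lt
      intro hlt
      exact hg (Subgroup.subset_closure (Or.inl ⟨fun hgN => hg (hNH hgN), hlt⟩))
    rcases gd_or_exponent_two H hne hinv with h | h
    · exact hngd h
    · have hTne : T.Nonempty := by
        apply Set.nonempty_of_ncard_ne_zero
        omega
      obtain ⟨x, hx⟩ := hTne
      have hxx : x * x = 1 := Subtype.ext (h x (hNH x.2))
      have hxi : x⁻¹ = x := inv_eq_of_mul_eq_one_left hxx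
      have : x ∈ T ∩ T⁻¹ := ⟨hx, by rw [Set.mem_inv, hxi]; exact hx⟩
      rw [hTorient] at this
      exact this
  have hcomm : ∀ a b : G ⧸ N, a * b = b * a := by
    intro a b
    have hi : ∀ q : G ⧸ N, q⁻¹ = q := fun q =>
      inv_eq_of_mul_eq_one_left (by rw [← pow_two]; exact hquot q)
    calc a * b = (a * b)⁻¹ := (hi _).symm
      _ = b⁻¹ * a⁻¹ := mul_inv_rev _ _
      _ = b * a := by rw [hi, hi]
  let cg : CommGroup (G ⧸ N) :=
    { (inferInstance : Group (G ⧸ N)) with mul_comm := hcomm }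
  have hXq : Subgroup.closure (QuotientGroup.mk' N '' X) = ⊤ := by
    rw [← MonoidHom.map_closure, eq_top_iff,
      ← Subgroup.map_top_of_surjective _ (QuotientGroup.mk'_surjective N), ← hHtop, hHdef,
      Subgroup.closure_union, Subgroup.map_sup, Subgroup.closure_eq,
      QuotientGroup.map_mk'_self, sup_bot_eq]
  obtain ⟨b, hbX, hb⟩ := @exists_min_gen_in (G ⧸ N) cg _ hquot _ hXq κ hκ.1 hκ.2
  choose a haX hab using hbX
  refine ⟨a, fun i => (haX i).1, ?_, fun i => (haX i).2⟩
  have hba : Set.range b = QuotientGroup.mk' N '' Set.range a := by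
    rw [← Set.range_comp]
    congr 1
    funext i
    exact (hab i).symm
  have hb' : Subgroup.closure (QuotientGroup.mk' N '' Set.range a) = ⊤ := by
    rw [← hba]; exact hb
  rw [← MonoidHom.map_closure] at hb'
  rw [Subgroup.closure_union, Subgroup.closure_eq]
  have := congrArg (Subgroup.comap (QuotientGroup.mk' N)) hb'
  rw [Subgroup.comap_map_eq, QuotientGroup.ker_mk', Subgroup.comap_top] at this
  exact this
end

section
/- Let B be an elementary abelian 2-group of rank k ≥ 6 with generating tuple (z_1,…,z_k), and let T be the Imrich generating set for B with respect to (z_1,…,z_k). Let G be a group with B ≤ G, let Bx be a coset of B in G, and let S be any subset of G with S ∩ Bx = Tx ∪ {x}. Then in Cay(G,S), x is the only vertex of S ∩ Bx that has at least three mutual inneighbours via elements of S ∩ Bx with every other vertex of S ∩ Bx. -/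
section CosetDefs

variable {G : Type*} [Group G]

/-- The right coset `B * x` as a subset of `G`. -/
def rightCosetSet (B : Subgroup G) (x : G) : Set G := (· * x) '' (B : Set G)

/-- In `Cay(G,S)`, `w` is a mutual inneighbour of `u` and `v` via elements of
`X` (a subset of the connection set): both `u * w⁻¹ ∈ X` and `v * w⁻¹ ∈ X`. -/
def IsMutualInNbrVia (X : Set G) (u v w : G) : Prop := u * w⁻¹ ∈ X ∧ v * w⁻¹ ∈ X

/-- `u` and `v` have at least three mutual inneighbours via elements of `X`. -/
def HasThreeMutualInNbrsVia (X : Set G) (u v : G) : Prop :=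
  ∃ w₁ w₂ w₃ : G, w₁ ≠ w₂ ∧ w₁ ≠ w₃ ∧ w₂ ≠ w₃ ∧
    IsMutualInNbrVia X u v w₁ ∧ IsMutualInNbrVia X u v w₂ ∧ IsMutualInNbrVia X u v w₃

end CosetDefs


inductive ICode | o | e (i : ℕ) | f (i : ℕ) | p | q

def ICode.valid (k : ℕ) : ICode → Prop
  | .o => True | .e i => i < k | .f i => i + 1 < k | .p => True | .q => True

def ICode.ev (k : ℕ) : ICode → ℕ → Prop
  | .o, _ => False
  | .e i, n => n = i
  | .f i, n => n = i ∨ n = i + 1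
  | .p, n => n = 0 ∨ n = 1 ∨ n = k - 3 ∨ n = k - 2
  | .q, n => n = 0 ∨ n = 1 ∨ n = k - 2 ∨ n = k - 1

/-- the points worth testing -/
def ICode.pts (k : ℕ) : ICode → List ℕ
  | .o => [] | .e i => [i] | .f i => [i, i+1] | .p => [0,1,k-3,k-2] | .q => [0,1,k-2,k-1]

theorem uniq_e (k : ℕ) (hk : 6 ≤ k) (i : ℕ) (hi : i + 3 < k) (s t : ICode) (hs : s.valid k)
    (ht : t.valid k) (h : ∀ n, ((s.ev k n ↔ t.ev k n) ↔ (n = i ↔ n = i + 3))) :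
    s = .e i ∨ s = .e (i+3) := by
  have h1 : ∀ n ∈ s.pts k ++ t.pts k ++ [i, i+3], _ := fun n _ => h n
  clear h
  cases s <;> cases t <;> simp [ICode.ev, ICode.valid, ICode.pts] at * <;> omega

theorem uniq_f (k : ℕ) (hk : 6 ≤ k) (i : ℕ) (hi : i + 3 < k) (s t : ICode) (hs : s.valid k)
    (ht : t.valid k) (h : ∀ n, ((s.ev k n ↔ t.ev k n) ↔ ((n = i ∨ n = i+1) ↔ (n = i + 2 ∨ n = i+3)))) :
    s = .f i ∨ s = .f (i+2) := by
  have h1 : ∀ n ∈ s.pts k ++ t.pts k ++ [i, i+1, i+2, i+3], _ := fun n _ => h n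
  clear h
  cases s <;> cases t <;> simp [ICode.ev, ICode.valid, ICode.pts] at * <;> omega

theorem uniq_p (k : ℕ) (hk : 6 ≤ k) (s t : ICode) (hs : s.valid k)
    (ht : t.valid k) (h : ∀ n, ((s.ev k n ↔ t.ev k n) ↔ (ICode.ev k .p n ↔ n = 2))) :
    s = .p ∨ s = .e 2 := by
  have h1 : ∀ n ∈ s.pts k ++ t.pts k ++ [0,1,2,k-3,k-2], _ := fun n _ => h n
  clear h
  cases s <;> cases t <;> simp [ICode.ev, ICode.valid, ICode.pts] at * <;> omega

theorem uniq_q (k : ℕ) (hk : 6 ≤ k) (s t : ICode) (hs : s.valid k)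
    (ht : t.valid k) (h : ∀ n, ((s.ev k n ↔ t.ev k n) ↔ (ICode.ev k .q n ↔ n = 2))) :
    s = .q ∨ s = .e 2 := by
  have h1 : ∀ n ∈ s.pts k ++ t.pts k ++ [0,1,2,k-2,k-1], _ := fun n _ => h n
  clear h
  cases s <;> cases t <;> simp [ICode.ev, ICode.valid, ICode.pts] at * <;> omega

theorem exists_coord {G : Type*} [Group G] (k : ℕ) 
    (B : Subgroup G)
    (hBcomm : ∀ a ∈ B, ∀ b ∈ B, a * b = b * a)
    (hBexp : ∀ b ∈ B, b ^ 2 = 1)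
    (hBcard : Nat.card B = 2 ^ k)
    (z : ℕ → G) (hzB : ∀ i < k, z i ∈ B)
    (hzgen : Subgroup.closure (z '' Set.Iio k) = B) :
    ∃ χ : ℕ → G → Prop, (∀ n, ∀ a ∈ B, ∀ b ∈ B, (χ n (a * b) ↔ ¬ (χ n a ↔ χ n b))) ∧
      (∀ n, ∀ i < k, (χ n (z i) ↔ n = i)) := by
  classical
  let _ : CommGroup B := { (inferInstance : Group B) with
    mul_comm := fun a b => Subtype.ext (hBcomm a a.2 b b.2) }
  let _ : Module (ZMod 2) (Additive B) := AddCommGroup.zmodModule (n := 2) (by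
    intro x
    exact Subtype.ext (hBexp _ (Additive.toMul x).2))
  have : Finite B := Nat.finite_of_card_ne_zero (by rw [hBcard]; positivity)
  have : Finite (Additive B) := ‹Finite B›
  have : Module.Finite (ZMod 2) (Additive B) := Module.Finite.of_finite
  have hfr : Module.finrank (ZMod 2) (Additive B) = k := by
    have h := Module.natCard_eq_pow_finrank (K := ZMod 2) (V := Additive B)
    have h2 : Nat.card (Additive B) = 2 ^ k := hBcard
    rw [h2, Nat.card_zmod] at h
    exact (Nat.pow_right_injective (le_refl 2) h).symm
  let w : Fin k → Additive B := fun i => Additive.ofMul ⟨z i, hzB i i.2⟩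
  have hspan : ⊤ ≤ Submodule.span (ZMod 2) (Set.range w) := by
    have key : ∀ g (hg : g ∈ Subgroup.closure (z '' Set.Iio k)) (hb : g ∈ B),
        (Additive.ofMul ⟨g, hb⟩ : Additive B) ∈ Submodule.span (ZMod 2) (Set.range w) := by
      intro g hg
      induction hg using Subgroup.closure_induction with
      | mem y hy =>
        intro hb
        obtain ⟨i, hi, rfl⟩ := hy
        exact Submodule.subset_span ⟨⟨i, hi⟩, rfl⟩
      | one => intro hb; exact Submodule.zero_mem _
      | mul a b ha hb iha ihb =>
        intro hab
        exact Submodule.add_mem _ (iha (hzgen ▸ ha)) (ihb (hzgen ▸ hb))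
      | inv a ha iha =>
        intro hab
        exact Submodule.neg_mem _ (iha (hzgen ▸ ha))
    intro y _
    exact key (Additive.toMul y).1 (by rw [hzgen]; exact (Additive.toMul y).2) (Additive.toMul y).2
  let b := basisOfTopLeSpanOfCardEqFinrank w hspan (by simp [hfr])
  have hbw : ∀ i, b i = w i := fun i => by simp [b]
  refine ⟨fun n g => ∃ (hn : n < k) (hg : g ∈ B), b.repr (Additive.ofMul ⟨g, hg⟩) ⟨n, hn⟩ = 1, ?_, ?_⟩
  · intro n a ha c hc
    by_cases hn : n < k
    · simp only [hn, ha, hc, B.mul_mem ha hc, exists_true_left]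
      have : (Additive.ofMul ⟨a * c, B.mul_mem ha hc⟩ : Additive B) =
        Additive.ofMul ⟨a, ha⟩ + Additive.ofMul ⟨c, hc⟩ := rfl
      rw [this, map_add, Finsupp.add_apply]
      generalize b.repr (Additive.ofMul ⟨a, ha⟩) ⟨n, hn⟩ = r
      generalize b.repr (Additive.ofMul ⟨c, hc⟩) ⟨n, hn⟩ = s
      revert r s
      decide
    · simp [hn]
  · intro n i hi
    have : (Additive.ofMul ⟨z i, hzB i hi⟩ : Additive B) = b ⟨i, hi⟩ := (hbw ⟨i, hi⟩).symm
    by_cases hn : n < k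
    · simp only [hn, hzB i hi, exists_true_left, this, Module.Basis.repr_self]
      rw [Finsupp.single_apply]
      simp [eq_comm]
    · simp [hn]; omega

theorem ICode.ev_inj (k : ℕ) (hk : 6 ≤ k) (s t : ICode) (hs : s.valid k)
    (ht : t.valid k) (h : ∀ n, s.ev k n ↔ t.ev k n) : s = t := by
  have h1 : ∀ n ∈ s.pts k ++ t.pts k, _ := fun n _ => h n
  clear h
  cases s <;> cases t <;> simp [ICode.ev, ICode.valid, ICode.pts] at * <;> omega

/-- The group element encoded by a code. -/
def ICode.val {G : Type*} [Group G] (k : ℕ) (z : ℕ → G) : ICode → G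
  | .o => 1
  | .e i => z i
  | .f i => z i * z (i + 1)
  | .p => z 0 * z 1 * z (k - 3) * z (k - 2)
  | .q => z 0 * z 1 * z (k - 2) * z (k - 1)

theorem ICode.mem_iff {G : Type*} [Group G] (k : ℕ) (z : ℕ → G) (x y : G) :
    y ∈ (· * x) '' (imrichSet k z) ∪ {x} ↔ ∃ s : ICode, s.valid k ∧ y = s.val k z * x := by
  constructor
  · rintro (⟨g, ((⟨i, hi, rfl⟩ | ⟨i, hi, rfl⟩) | (rfl | rfl)), rfl⟩ | rfl)
    · exact ⟨.e i, hi, rfl⟩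
    · exact ⟨.f i, hi, rfl⟩
    · exact ⟨.p, trivial, rfl⟩
    · exact ⟨.q, trivial, rfl⟩
    · exact ⟨.o, trivial, (one_mul _).symm⟩
  · rintro ⟨s, hs, rfl⟩
    cases s with
    | o => right; exact one_mul _
    | e i => left; exact ⟨_, Or.inl (Or.inl ⟨i, hs, rfl⟩), rfl⟩
    | f i => left; exact ⟨_, Or.inl (Or.inr ⟨i, hs, rfl⟩), rfl⟩
    | p => left; exact ⟨_, Or.inr (Or.inl rfl), rfl⟩
    | q => left; exact ⟨_, Or.inr (Or.inr rfl), rfl⟩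

theorem imrich_coset_mutual_innbrs {G : Type*} [Group G] (k : ℕ) (hk : 6 ≤ k)
    (B : Subgroup G)
    (hBcomm : ∀ a ∈ B, ∀ b ∈ B, a * b = b * a)
    (hBexp : ∀ b ∈ B, b ^ 2 = 1)
    (hBcard : Nat.card B = 2 ^ k)
    (z : ℕ → G) (hzB : ∀ i < k, z i ∈ B)
    (hzgen : Subgroup.closure (z '' Set.Iio k) = B)
    (T : Set G) (hT : T = imrichSet k z)
    (x : G) (S : Set G)
    (hS : S ∩ rightCosetSet B x = (· * x) '' T ∪ {x}) :
    ∀ u ∈ S ∩ rightCosetSet B x,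
      ((∀ v ∈ S ∩ rightCosetSet B x, v ≠ u →
          HasThreeMutualInNbrsVia (S ∩ rightCosetSet B x) u v) ↔ u = x) := by
  obtain ⟨χ, hmul, hz⟩ := exists_coord k B hBcomm hBexp hBcard z hzB hzgen
  rw [hS, hT]
  have hX := ICode.mem_iff k z x
  generalize (· * x) '' (imrichSet k z) ∪ {x} = X at hX ⊢
  have hB : ∀ s : ICode, s.valid k → s.val k z ∈ B := by
    intro s hs
    cases s with
    | o => exact B.one_mem
    | e i => exact hzB i hs
    | f i => exact B.mul_mem (hzB i (by simp [ICode.valid] at hs; omega)) (hzB _ hs)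
    | p => exact B.mul_mem (B.mul_mem (B.mul_mem (hzB _ (by omega)) (hzB _ (by omega)))
            (hzB _ (by omega))) (hzB _ (by omega))
    | q => exact B.mul_mem (B.mul_mem (B.mul_mem (hzB _ (by omega)) (hzB _ (by omega)))
            (hzB _ (by omega))) (hzB _ (by omega))
  have hχ : ∀ s : ICode, s.valid k → ∀ n, (χ n (s.val k z) ↔ s.ev k n) := by
    intro s hs n
    have h4 : ∀ i j, i < k → j < k → (χ n (z 0 * z 1 * z i * z j) ↔
        ¬ (¬ (¬ (n = 0 ↔ n = 1) ↔ n = i) ↔ n = j)) := by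
      intro i j hi hj
      have h0 := hzB 0 (by omega)
      have h1 := hzB 1 (by omega)
      rw [hmul n _ (B.mul_mem (B.mul_mem h0 h1) (hzB i hi)) _ (hzB j hj),
        hmul n _ (B.mul_mem h0 h1) _ (hzB i hi), hmul n _ h0 _ h1,
        hz n 0 (by omega), hz n 1 (by omega), hz n i hi, hz n j hj]
    cases s with
    | o =>
      have := hmul n 1 B.one_mem 1 B.one_mem
      simp only [mul_one] at this
      simp only [ICode.val, ICode.ev]
      tauto
    | e i => exact hz n i hs
    | f i =>
      simp only [ICode.valid] at hs
      simp only [ICode.val, ICode.ev]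
      rw [hmul n _ (hzB i (by omega)) _ (hzB _ hs), hz n i (by omega), hz n _ hs]
      omega
    | p =>
      simp only [ICode.val, ICode.ev]
      rw [h4 _ _ (by omega) (by omega)]
      omega
    | q =>
      simp only [ICode.val, ICode.ev]
      rw [h4 _ _ (by omega) (by omega)]
      omega
  have hinj : ∀ s t : ICode, s.valid k → t.valid k → s.val k z = t.val k z → s = t := by
    intro s t hs ht h
    refine ICode.ev_inj k hk s t hs ht fun n => ?_
    rw [← hχ s hs, ← hχ t ht, h]
  have hsq : ∀ a ∈ B, a * a = 1 := fun a ha => by rw [← pow_two]; exact hBexp a ha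
  -- the unique-representation criterion
  have hno : ∀ a b : ICode, a.valid k → b.valid k →
      (∀ s t : ICode, s.valid k → t.valid k →
        (∀ n, ((s.ev k n ↔ t.ev k n) ↔ (a.ev k n ↔ b.ev k n))) → s = a ∨ s = b) →
      ¬ HasThreeMutualInNbrsVia X (a.val k z * x) (b.val k z * x) := by
    intro a b ha hb huniq
    have key : ∀ w, IsMutualInNbrVia X (a.val k z * x) (b.val k z * x) w →
        w = x⁻¹ * (a.val k z)⁻¹ * a.val k z * x ∨ w = x⁻¹ * (b.val k z)⁻¹ * a.val k z * x := by
      rintro w ⟨h1, h2⟩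
      obtain ⟨s, hs, h1⟩ := (hX _).1 h1
      obtain ⟨t, ht, h2⟩ := (hX _).1 h2
      have hw : w = x⁻¹ * (s.val k z)⁻¹ * a.val k z * x := by
        have := mul_inv_eq_iff_eq_mul.1 h1
        rw [mul_assoc, mul_assoc, this]; group
      have hst : s = a ∨ s = b := by
        apply huniq s t hs ht
        intro n
        have e1 : (a.val k z)⁻¹ * s.val k z = (b.val k z)⁻¹ * t.val k z := by
          have e2 : x * w⁻¹ = (a.val k z)⁻¹ * s.val k z * x := by
            rw [mul_assoc, ← h1]; group
          have e3 : x * w⁻¹ = (b.val k z)⁻¹ * t.val k z * x := by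
            rw [mul_assoc, ← h2]; group
          exact mul_right_cancel (e2.symm.trans e3)
        rw [inv_eq_of_mul_eq_one_left (hsq _ (hB a ha)),
          inv_eq_of_mul_eq_one_left (hsq _ (hB b hb))] at e1
        have e4 := hmul n _ (hB a ha) _ (hB s hs)
        rw [e1, hmul n _ (hB b hb) _ (hB t ht), hχ a ha, hχ b hb, hχ s hs, hχ t ht] at e4
        tauto
      rcases hst with rfl | rfl
      · left; exact hw
      · right; exact hw
    rintro ⟨w1, w2, w3, h12, h13, h23, k1, k2, k3⟩
    rcases key _ k1 with r1 | r1 <;> rcases key _ k2 with r2 | r2 <;>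
      rcases key _ k3 with r3 | r3 <;> simp_all
  intro u hu
  obtain ⟨a, ha, rfl⟩ := (hX u).1 hu
  constructor
  · intro hall
    by_contra hne
    have step : ∀ b : ICode, b.valid k → b ≠ a →
      ¬ (∀ s t : ICode, s.valid k → t.valid k →
        (∀ n, ((s.ev k n ↔ t.ev k n) ↔ (a.ev k n ↔ b.ev k n))) → s = a ∨ s = b) := by
      intro b hb hba huniq
      refine hno a b ha hb huniq (hall _ ((hX _).2 ⟨b, hb, rfl⟩) ?_)
      intro h
      exact hba (hinj b a hb ha (mul_right_cancel h))
    cases a with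
    | o => exact hne (one_mul x)
    | e i =>
      simp only [ICode.valid] at ha
      by_cases hi : i + 3 < k
      · exact step (.e (i + 3)) hi (by simp) fun s t hs ht h =>
          uniq_e k hk i hi s t hs ht h
      · obtain ⟨j, rfl⟩ : ∃ j, i = j + 3 := ⟨i - 3, by omega⟩
        exact step (.e j) (show j < k by omega) (by simp) fun s t hs ht h =>
          (uniq_e k hk j ha s t hs ht (fun n => (h n).trans Iff.comm)).symm
    | f i =>
      simp only [ICode.valid] at ha
      by_cases hi : i + 3 < k
      · exact step (.f (i + 2)) hi (by simp) fun s t hs ht h =>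
          uniq_f k hk i hi s t hs ht h
      · obtain ⟨j, rfl⟩ : ∃ j, i = j + 2 := ⟨i - 2, by omega⟩
        exact step (.f j) (show j + 1 < k by omega) (by simp) fun s t hs ht h =>
          (uniq_f k hk j ha s t hs ht (fun n => (h n).trans Iff.comm)).symm
    | p => exact step (.e 2) (show 2 < k by omega) (by simp) fun s t hs ht h =>
          uniq_p k hk s t hs ht h
    | q => exact step (.e 2) (show 2 < k by omega) (by simp) fun s t hs ht h =>
          uniq_q k hk s t hs ht h
  · intro hax v hv hvu
    rw [hax] at hvu ⊢
    obtain ⟨b, hb, rfl⟩ := (hX v).1 hv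
    have hbo : b ≠ .o := by
      rintro rfl
      exact hvu (one_mul x)
    have hthird : ∃ t t' : ICode, t.valid k ∧ t'.valid k ∧ t ≠ .o ∧ t ≠ b ∧
        b.val k z * t.val k z = t'.val k z := by
      have hA : ∀ A ∈ B, ∀ C ∈ B, A * C * A = C := fun A h C h' => by
        rw [hBcomm A h C h', mul_assoc, hsq A h, mul_one]
      cases b with
      | o => exact absurd rfl hbo
      | e i =>
        simp only [ICode.valid] at hb
        by_cases hi : i + 1 < k
        · exact ⟨.e (i + 1), .f i, hi, hi, by simp, by simp, rfl⟩
        · obtain ⟨j, rfl⟩ : ∃ j, i = j + 1 := ⟨i - 1, by omega⟩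
          exact ⟨.e j, .f j, show j < k by omega, hb, by simp, by simp,
            hBcomm _ (hzB _ hb) _ (hzB _ (by omega))⟩
      | f i =>
        simp only [ICode.valid] at hb
        exact ⟨.e i, .e (i + 1), show i < k by omega, hb, by simp, by simp,
          hA _ (hzB _ (by omega)) _ (hzB _ hb)⟩
      | p =>
        refine ⟨.f 0, .f (k - 3), show 0 + 1 < k by omega, show k - 3 + 1 < k by omega,
          by simp, by simp, ?_⟩
        simp only [ICode.val, zero_add]
        rw [show k - 3 + 1 = k - 2 by omega, mul_assoc (z 0 * z 1)]
        exact hA _ (B.mul_mem (hzB _ (by omega)) (hzB _ (by omega))) _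
          (B.mul_mem (hzB _ (by omega)) (hzB _ (by omega)))
      | q =>
        refine ⟨.f 0, .f (k - 2), show 0 + 1 < k by omega, show k - 2 + 1 < k by omega,
          by simp, by simp, ?_⟩
        simp only [ICode.val, zero_add]
        rw [show k - 2 + 1 = k - 1 by omega, mul_assoc (z 0 * z 1)]
        exact hA _ (B.mul_mem (hzB _ (by omega)) (hzB _ (by omega))) _
          (B.mul_mem (hzB _ (by omega)) (hzB _ (by omega)))
    obtain ⟨t, t', ht, ht', hto, htb, hbt⟩ := hthird
    have hne : ∀ s r : ICode, s.valid k → r.valid k → s ≠ r →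
        x⁻¹ * (s.val k z)⁻¹ * x ≠ x⁻¹ * (r.val k z)⁻¹ * x := by
      intro s r hs hr hsr h
      apply hsr
      apply hinj s r hs hr
      exact inv_injective (mul_left_cancel (mul_right_cancel h))
    have hmut : ∀ s r : ICode, s.valid k → r.valid k → b.val k z * s.val k z = r.val k z →
        IsMutualInNbrVia X x (b.val k z * x) (x⁻¹ * (s.val k z)⁻¹ * x) := by
      intro s r hs hr h
      refine ⟨(hX _).2 ⟨s, hs, by group⟩, (hX _).2 ⟨r, hr, ?_⟩⟩
      rw [← h]; group
    have ho : ICode.valid k .o := trivial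
    exact ⟨_, _, _, hne .o b ho hb hbo.symm, hne .o t ho ht hto.symm, hne b t hb ht htb.symm,
      hmut .o b ho hb (mul_one _), hmut b .o hb ho (hsq _ (hB b hb)), hmut t t' ht ht' hbt⟩
end

section
/- Let B be an elementary abelian 2-group of rank k ≥ 6, and let T be the Imrich generating set for B with respect to some generating tuple. Let G be a group with B ≤ G, let Bx be a coset of B in G, and let S be any subset of G with S ∩ Bx = (Bx ∖ Tx) ∖ {x}. If Aut(Cay(G,S))_1 fixes S ∩ Bx setwise, then Aut(Cay(G,S))_1 fixes the element x. -/
namespace ImrichAux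

/-- Names for the elements of `T ∪ {1}`. -/
inductive Code where
  | e : Code
  | s : ℕ → Code
  | p : ℕ → Code
  | a : Code
  | b : Code

/-- Which names are meaningful for rank `k`. -/
def Code.valid (k : ℕ) : Code → Prop
  | .e => True
  | .s i => i < k
  | .p i => i + 1 < k
  | .a => True
  | .b => True

/-- Support of the named element. -/
def Code.mem (k : ℕ) : Code → ℕ → Prop
  | .e, _ => False
  | .s i, n => n = i
  | .p i, n => n = i ∨ n = i + 1
  | .a, n => n = 0 ∨ n = 1 ∨ n = k - 3 ∨ n = k - 2
  | .b, n => n = 0 ∨ n = 1 ∨ n = k - 2 ∨ n = k - 1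

/-- The named element. -/
def Code.el {G : Type*} [Group G] (k : ℕ) (z : ℕ → G) : Code → G
  | .e => 1
  | .s i => z i
  | .p i => z i * z (i + 1)
  | .a => z 0 * z 1 * z (k - 3) * z (k - 2)
  | .b => z 0 * z 1 * z (k - 2) * z (k - 1)

/-- Partner of a code with which it has a unique decomposition. -/
def Code.partner : Code → Code
  | .e => .e
  | .s i => if i < 3 then .s (i + 3) else .s (i - 3)
  | .p i => if i = 0 then .p 2 else if i = 1 then .p 3 else if i = 2 then .p 0 else .p 1
  | .a => .s 2
  | .b => .s 2

lemma partner_valid (k : ℕ) (hk : 6 ≤ k) (t : Code) (ht : t.valid k) : t.partner.valid k := by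
  cases t with
  | s i => simp only [Code.partner]; split_ifs <;> simp only [Code.valid] at * <;> omega
  | p i => simp only [Code.partner]; split_ifs <;> simp only [Code.valid] at * <;> omega
  | _ => simp only [Code.partner, Code.valid] <;> omega

lemma comb_s (k : ℕ) (hk : 6 ≤ k) (i j : ℕ) (hi : i < k) (hj : j < k) (hij : i + 3 ≤ j)
    (u v : Code) (hu : u.valid k) (hv : v.valid k)
    (h : ∀ n < k, ((u.mem k n ↔ v.mem k n) ↔ ((Code.s i).mem k n ↔ (Code.s j).mem k n))) :
    u = .s i ∨ u = .s j := by
  have hi' := h i hi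
  have hj' := h j hj
  have h0 := h 0 (by omega)
  have h1 := h 1 (by omega)
  have h3 := h (k-3) (by omega)
  have h4 := h (k-2) (by omega)
  have h5 := h (k-1) (by omega)
  cases u with
  | e => 
    cases v with
    | _ => simp only [Code.mem, Code.valid] at * ; first | grind | grind (splits := 30)
  | s c => 
    have hc := h c hu
    cases v with
    | _ => simp only [Code.mem, Code.valid] at * ; first | grind | grind (splits := 30)
  | p c => 
    have hc := h c (by simp only [Code.valid] at hu; omega)
    have hc' := h (c+1) hu
    cases v with
    | _ => simp only [Code.mem, Code.valid] at * ; first | grind | grind (splits := 30)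
  | a => 
    cases v with
    | _ => simp only [Code.mem, Code.valid] at * ; first | grind | grind (splits := 30)
  | b => 
    cases v with
    | _ => simp only [Code.mem, Code.valid] at * ; first | grind | grind (splits := 30)

lemma comb_p (k : ℕ) (hk : 6 ≤ k) (i j : ℕ) (hj : j + 1 < k)
    (hij : i = 0 ∧ j = 2 ∨ i = 1 ∧ 3 ≤ j)
    (u v : Code) (hu : u.valid k) (hv : v.valid k)
    (h : ∀ n < k, ((u.mem k n ↔ v.mem k n) ↔ ((Code.p i).mem k n ↔ (Code.p j).mem k n))) :
    u = .p i ∨ u = .p j := by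
  have hj' := h j (by omega)
  have hj'' := h (j+1) (by omega)
  have h0 := h 0 (by omega)
  have h1 := h 1 (by omega)
  have h2 := h 2 (by omega)
  have h3 := h (k-3) (by omega)
  have h4 := h (k-2) (by omega)
  have h5 := h (k-1) (by omega)
  rcases hij with ⟨rfl, rfl⟩ | ⟨rfl, hij⟩ <;>
  cases u with
  | e => 
    cases v with
    | _ => simp only [Code.mem, Code.valid] at * ; first | grind | grind (splits := 30)
  | s c => 
    have hc := h c hu
    cases v with
    | _ => simp only [Code.mem, Code.valid] at * ; first | grind | grind (splits := 30)
  | p c => 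
    have hc := h c (by simp only [Code.valid] at hu; omega)
    have hc' := h (c+1) hu
    cases v with
    | _ => simp only [Code.mem, Code.valid] at * ; first | grind | grind (splits := 30)
  | a => 
    cases v with
    | _ => simp only [Code.mem, Code.valid] at * ; first | grind | grind (splits := 30)
  | b => 
    cases v with
    | _ => simp only [Code.mem, Code.valid] at * ; first | grind | grind (splits := 30)

lemma comb_ab (k : ℕ) (hk : 6 ≤ k) (t : Code) (ht : t = .a ∨ t = .b)
    (u v : Code) (hu : u.valid k) (hv : v.valid k)
    (h : ∀ n < k, ((u.mem k n ↔ v.mem k n) ↔ (t.mem k n ↔ (Code.s 2).mem k n))) :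
    u = t ∨ u = .s 2 := by
  have h0 := h 0 (by omega)
  have h1 := h 1 (by omega)
  have h2 := h 2 (by omega)
  have h3 := h (k-3) (by omega)
  have h4 := h (k-2) (by omega)
  have h5 := h (k-1) (by omega)
  rcases ht with rfl | rfl <;>
  cases u with
  | e => 
    cases v with
    | _ => simp only [Code.mem, Code.valid] at * ; first | grind | grind (splits := 30)
  | s c => 
    have hc := h c hu
    cases v with
    | _ => simp only [Code.mem, Code.valid] at * ; first | grind | grind (splits := 30)
  | p c => 
    have hc := h c (by simp only [Code.valid] at hu; omega)
    have hc' := h (c+1) hu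
    cases v with
    | _ => simp only [Code.mem, Code.valid] at * ; first | grind | grind (splits := 30)
  | a => 
    cases v with
    | _ => simp only [Code.mem, Code.valid] at * ; first | grind | grind (splits := 30)
  | b => 
    cases v with
    | _ => simp only [Code.mem, Code.valid] at * ; first | grind | grind (splits := 30)

lemma comb (k : ℕ) (hk : 6 ≤ k) (t : Code) (ht : t.valid k) (hte : t ≠ .e)
    (u v : Code) (hu : u.valid k) (hv : v.valid k)
    (h : ∀ n < k, ((u.mem k n ↔ v.mem k n) ↔ (t.mem k n ↔ t.partner.mem k n))) :
    u = t ∨ u = t.partner := by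
  have h' : ∀ n < k, ((u.mem k n ↔ v.mem k n) ↔ (t.partner.mem k n ↔ t.mem k n)) := by
    intro n hn
    rw [h n hn]; exact iff_comm
  cases t with
  | e => exact absurd rfl hte
  | a => exact comb_ab k hk _ (Or.inl rfl) u v hu hv h
  | b => exact comb_ab k hk _ (Or.inr rfl) u v hu hv h
  | s i =>
    simp only [Code.valid] at ht
    simp only [Code.partner] at *
    split_ifs at * with h1
    · exact comb_s k hk i (i+3) ht (by omega) le_rfl u v hu hv h
    · exact (comb_s k hk (i-3) i (by omega) ht (by omega) u v hu hv h').symm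
  | p i =>
    simp only [Code.valid] at ht
    simp only [Code.partner] at *
    split_ifs at * with h1 h2 h3
    · exact comb_p k hk i 2 (by omega) (by omega) u v hu hv h
    · exact comb_p k hk i 3 (by omega) (by omega) u v hu hv h
    · exact (comb_p k hk 0 i (by omega) (by omega) u v hu hv h').symm
    · exact (comb_p k hk 1 i (by omega) (by omega) u v hu hv h').symm

/-- Coordinates on an elementary abelian 2-group. -/
lemma exists_coords {A : Type*} [CommGroup A] (k : ℕ) (hexp : ∀ b : A, b ^ 2 = 1)
    (hcard : Nat.card A = 2 ^ k) (z : Fin k → A)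
    (hgen : Subgroup.closure (Set.range z) = ⊤) :
    ∃ χ : A → Fin k → ZMod 2, (∀ a b, χ (a * b) = χ a + χ b) ∧
      ∀ i n, χ (z i) n = if n = i then 1 else 0 := by
  classical
  haveI : Finite A := Nat.finite_of_card_ne_zero (by rw [hcard]; positivity)
  letI : Module (ZMod 2) (Additive A) := AddCommGroup.zmodModule (n := 2) (fun b => hexp b.toMul)
  haveI : Module.Finite (ZMod 2) (Additive A) := Module.Finite.of_finite
  have hfr : Module.finrank (ZMod 2) (Additive A) = k := by
    have h1 := Module.natCard_eq_pow_finrank (K := ZMod 2) (V := Additive A)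
    have h2 : Nat.card (Additive A) = 2 ^ k := hcard
    rw [h2, Nat.card_zmod] at h1
    exact (Nat.pow_right_injective le_rfl h1).symm
  have hspan : ⊤ ≤ Submodule.span (ZMod 2) (Set.range (fun i => Additive.ofMul (z i))) := by
    intro v _
    have hv : v.toMul ∈ Subgroup.closure (Set.range z) := by rw [hgen]; trivial
    have key : ∀ y : A, y ∈ Subgroup.closure (Set.range z) → Additive.ofMul y ∈
        Submodule.span (ZMod 2) (Set.range (fun i => Additive.ofMul (z i))) := by
      intro y hy
      induction hy using Subgroup.closure_induction with
      | mem y hy => obtain ⟨i, rfl⟩ := hy; exact Submodule.subset_span ⟨i, rfl⟩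
      | one => exact Submodule.zero_mem _
      | mul a b _ _ ha hb => exact Submodule.add_mem _ ha hb
      | inv a _ ha => exact Submodule.neg_mem _ ha
    exact key _ hv
  let bs := basisOfTopLeSpanOfCardEqFinrank _ hspan (by simp [hfr])
  refine ⟨fun a i => bs.repr (Additive.ofMul a) i, ?_, ?_⟩
  · intro a b
    funext i
    simp [ofMul_mul]
  · intro i n
    have : Additive.ofMul (z i) = bs i := by simp [bs]
    simp only [this, Module.Basis.repr_self, Finsupp.single_apply]
    simp only [eq_comm]

/-- Abstract form of the argument. -/
lemma core {G : Type*} [Group G] (B : Subgroup G)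
    (hBcomm : ∀ a ∈ B, ∀ b ∈ B, a * b = b * a)
    (hBexp : ∀ b ∈ B, b * b = 1) (U : Set G) (hUB : U ⊆ B) (h1U : (1 : G) ∈ U)
    (hA : ∀ t ∈ U, t ≠ 1 → ∃ s ∈ U, s ≠ 1 ∧ s ≠ t ∧ t * s ∈ U)
    (hB : ∀ t ∈ U, t ≠ 1 → ∃ t' ∈ U, ∀ s ∈ U, ∀ s' ∈ U, s * s' = t * t' → s = t ∨ s = t')
    (hC : ∀ b ∈ B, ∃ c ∈ B, c ∉ U ∧ b * c ∉ U)
    (x : G) (X : Set G) (hX : ∀ g, g ∈ X ↔ g * x⁻¹ ∈ B ∧ g * x⁻¹ ∉ U)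
    (φ : Equiv.Perm G) (hφ : ∀ v w, v * w⁻¹ ∈ X ↔ φ v * (φ w)⁻¹ ∈ X) (h1 : φ 1 = 1) :
    φ x = x := by
  have hinv : ∀ b ∈ B, b⁻¹ = b := fun b hb => inv_eq_of_mul_eq_one_left (hBexp b hb)
  -- the relation of being in the same right coset of `B` is definable from `X`
  have e1 : ∀ u v, u * v⁻¹ ∈ B ↔ ∃ w, u * w⁻¹ ∈ X ∧ v * w⁻¹ ∈ X := by
    intro u v
    constructor
    · intro h
      obtain ⟨c, hc, hcU, hcU'⟩ := hC _ h
      refine ⟨x⁻¹ * c⁻¹ * v, ?_, ?_⟩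
      · rw [hX]
        have : u * (x⁻¹ * c⁻¹ * v)⁻¹ * x⁻¹ = u * v⁻¹ * c := by group
        rw [this]
        exact ⟨B.mul_mem h hc, hcU'⟩
      · rw [hX]
        have : v * (x⁻¹ * c⁻¹ * v)⁻¹ * x⁻¹ = c := by group
        rw [this]
        exact ⟨hc, hcU⟩
    · rintro ⟨w, hu, hv⟩
      rw [hX] at hu hv
      have : u * v⁻¹ = (u * w⁻¹ * x⁻¹) * (v * w⁻¹ * x⁻¹)⁻¹ := by group
      rw [this]
      exact B.mul_mem hu.1 (B.inv_mem hv.1)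
  have e2 : ∀ u v, u * v⁻¹ ∈ B ↔ φ u * (φ v)⁻¹ ∈ B := by
    intro u v
    rw [e1, e1]
    constructor
    · rintro ⟨w, hu, hv⟩
      exact ⟨φ w, (hφ _ _).1 hu, (hφ _ _).1 hv⟩
    · rintro ⟨w, hu, hv⟩
      obtain ⟨w, rfl⟩ := φ.surjective w
      exact ⟨w, (hφ _ _).2 hu, (hφ _ _).2 hv⟩
  have e3 : ∀ u w, u * w⁻¹ * x⁻¹ ∈ B ↔ ∃ v, v * w⁻¹ ∈ X ∧ u * v⁻¹ ∈ B := by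
    intro u w
    constructor
    · intro h
      obtain ⟨c, hc, hcU, -⟩ := hC 1 B.one_mem
      refine ⟨c * x * w, ?_, ?_⟩
      · rw [hX]
        have : c * x * w * w⁻¹ * x⁻¹ = c := by group
        rw [this]
        exact ⟨hc, hcU⟩
      · have : u * (c * x * w)⁻¹ = u * w⁻¹ * x⁻¹ * c⁻¹ := by group
        rw [this]
        exact B.mul_mem h (B.inv_mem hc)
    · rintro ⟨v, hv, huv⟩
      rw [hX] at hv
      have : u * w⁻¹ * x⁻¹ = (u * v⁻¹) * (v * w⁻¹ * x⁻¹) := by group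
      rw [this]
      exact B.mul_mem huv hv.1
  have e4 : ∀ u w, u * w⁻¹ * x⁻¹ ∈ B ↔ φ u * (φ w)⁻¹ * x⁻¹ ∈ B := by
    intro u w
    rw [e3, e3]
    constructor
    · rintro ⟨v, hu, hv⟩
      exact ⟨φ v, (hφ _ _).1 hu, (e2 _ _).1 hv⟩
    · rintro ⟨v, hu, hv⟩
      obtain ⟨v, rfl⟩ := φ.surjective v
      exact ⟨v, (hφ _ _).2 hu, (e2 _ _).2 hv⟩
  have e5 : ∀ u w, u * w⁻¹ * x⁻¹ ∈ U ↔ φ u * (φ w)⁻¹ * x⁻¹ ∈ U := by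
    intro u w
    have a1 := e4 u w
    have a2 := hφ u w
    rw [hX, hX] at a2
    have a3 := @hUB (u * w⁻¹ * x⁻¹)
    have a4 := @hUB (φ u * (φ w)⁻¹ * x⁻¹)
    simp only [SetLike.mem_coe] at a3 a4
    tauto
  have e6 : ∀ u, u * x⁻¹ ∈ U ↔ φ u * x⁻¹ ∈ U := by
    intro u
    simpa [h1] using e5 u 1
  by_contra hne
  set t := φ x * x⁻¹ with ht
  have htU : t ∈ U := (e6 x).1 (by simpa using h1U)
  have ht1 : t ≠ 1 := fun h => hne (mul_inv_eq_one.1 h)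
  obtain ⟨t', ht'U, huniq⟩ := hB t htU ht1
  have htt' : t' ≠ t := by
    rintro rfl
    obtain ⟨s, hs, -, hst, -⟩ := hA _ htU ht1
    rcases huniq s hs s hs (by rw [hBexp _ (hUB hs), hBexp _ (hUB htU)]) with h | h <;>
      exact hst h
  obtain ⟨y, hy⟩ := φ.surjective (t' * x)
  set r := y * x⁻¹ with hr
  have hyx : y = r * x := by simp [hr]
  have hrU : r ∈ U := (e6 y).2 (by rw [hy]; simpa using ht'U)
  have hr1 : r ≠ 1 := by
    intro h
    rw [hyx, h, one_mul] at hy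
    exact htt' (by rw [ht, hy]; group)
  obtain ⟨s, hsU, hs1, hsr, hrs⟩ := hA r hrU hr1
  -- each decomposition gives a vertex `φ w` taking one of two values
  have key : ∀ q ∈ U, r * q ∈ U →
      φ (x⁻¹ * q⁻¹ * x) = 1 ∨ φ (x⁻¹ * q⁻¹ * x) = x⁻¹ * t'⁻¹ * t * x := by
    intro q hq hrq
    have b1 : x * (x⁻¹ * q⁻¹ * x)⁻¹ * x⁻¹ ∈ U := by
      have : x * (x⁻¹ * q⁻¹ * x)⁻¹ * x⁻¹ = q := by group
      rwa [this]
    have b2 : y * (x⁻¹ * q⁻¹ * x)⁻¹ * x⁻¹ ∈ U := by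
      have : y * (x⁻¹ * q⁻¹ * x)⁻¹ * x⁻¹ = r * q := by rw [hyx]; group
      rwa [this]
    rw [e5] at b1 b2
    set W := φ (x⁻¹ * q⁻¹ * x)
    rw [hy] at b2
    have hφx : φ x = t * x := by simp [ht]
    rw [hφx] at b1
    set m := t * x * W⁻¹ * x⁻¹ with hm
    set m' := t' * x * W⁻¹ * x⁻¹ with hm'
    have hW : W = x⁻¹ * m⁻¹ * t * x := by rw [hm]; group
    have hmm : m * m' = t * t' := by
      have h3 : m' = t' * (t⁻¹ * m) := by rw [hm, hm']; group
      have hmB := hUB b1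
      have htB := hUB htU
      have ht'B := hUB ht'U
      have h4 : m * m' = m' * m := hBcomm _ (hUB b1) _ (hUB b2)
      rw [h4, h3, hinv t htB]
      calc t' * (t * m) * m = t' * t * (m * m) := by group
        _ = t * t' := by rw [hBexp m hmB, mul_one, hBcomm _ ht'B _ htB]
    rcases huniq m b1 m' b2 hmm with h | h
    · left; rw [hW, h]; group
    · right; rw [hW, h]
  have inj : ∀ q q' : G, φ (x⁻¹ * q⁻¹ * x) = φ (x⁻¹ * q'⁻¹ * x) → q = q' := by
    intro q q' h
    have := φ.injective h
    simpa using this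
  have k1 := key 1 h1U (by simpa using hrU)
  have k2 := key r hrU (by rw [hBexp _ (hUB hrU)]; exact h1U)
  have k3 := key s hsU hrs
  have i1 := inj 1 r
  have i2 := inj 1 s
  have i3 := inj s r
  rcases k1 with k1 | k1 <;> rcases k2 with k2 | k2 <;> rcases k3 with k3 | k3 <;>
    rw [k1, k2] at i1 <;> rw [k1, k3] at i2 <;> rw [k2, k3] at i3 <;>
    first
    | exact hr1 (i1 rfl).symm
    | exact hs1 (i2 rfl).symm
    | exact hsr (i3 rfl)

lemma pow_bound (k : ℕ) (hk : 6 ≤ k) : 4 * k + 4 < 2 ^ k := by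
  induction k, hk using Nat.le_induction with
  | base => norm_num
  | succ n hn ih => rw [pow_succ]; omega

lemma imrich_subset {G : Type*} [Group G] (k : ℕ) (z : ℕ → G) (g : G) :
    g ∈ insert 1 (imrichSet k z) ↔ ∃ c : Code, c.valid k ∧ g = c.el k z := by
  constructor
  · rintro (rfl | (⟨i, hi, rfl⟩ | ⟨i, hi, rfl⟩) | (rfl | rfl))
    · exact ⟨.e, trivial, rfl⟩
    · exact ⟨.s i, hi, rfl⟩
    · exact ⟨.p i, hi, rfl⟩
    · exact ⟨.a, trivial, rfl⟩
    · exact ⟨.b, trivial, rfl⟩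
  · rintro ⟨c, hc, rfl⟩
    cases c with
    | e => exact Or.inl rfl
    | s i => exact Or.inr (Or.inl (Or.inl ⟨i, hc, rfl⟩))
    | p i => exact Or.inr (Or.inl (Or.inr ⟨i, hc, rfl⟩))
    | a => exact Or.inr (Or.inr (Or.inl rfl))
    | b => exact Or.inr (Or.inr (Or.inr rfl))

lemma imrich_card {G : Type*} [Group G] (k : ℕ) (hk : 6 ≤ k) (z : ℕ → G) :
    ∃ F : Finset G, (F : Set G) = insert 1 (imrichSet k z) ∧ F.card ≤ 2 * k + 2 := by
  classical
  refine ⟨insert 1 ((Finset.range k).image z ∪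
    (Finset.range (k - 1)).image (fun i => z i * z (i + 1)) ∪
    {z 0 * z 1 * z (k - 3) * z (k - 2), z 0 * z 1 * z (k - 2) * z (k - 1)}), ?_, ?_⟩
  · ext g
    rw [imrichSet]
    simp only [Finset.coe_insert, Finset.coe_union, Finset.coe_image, Finset.coe_range,
      Finset.coe_singleton, Set.mem_insert_iff, Set.mem_union, Set.mem_image, Set.mem_Iio,
      Set.mem_setOf_eq, Set.mem_singleton_iff]
    have : (∃ i, i < k - 1 ∧ z i * z (i + 1) = g) ↔ (∃ i, i + 1 < k ∧ g = z i * z (i + 1)) := by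
      constructor <;> rintro ⟨i, hi, h⟩ <;> exact ⟨i, by omega, h.symm⟩
    rw [this]
  · refine (Finset.card_insert_le _ _).trans ?_
    have c1 := Finset.card_union_le ((Finset.range k).image z ∪
      (Finset.range (k - 1)).image (fun i => z i * z (i + 1)))
      {z 0 * z 1 * z (k - 3) * z (k - 2), z 0 * z 1 * z (k - 2) * z (k - 1)}
    have c2 := Finset.card_union_le ((Finset.range k).image z)
      ((Finset.range (k - 1)).image (fun i => z i * z (i + 1)))
    have c3 := Finset.card_image_le (s := Finset.range k) (f := z)
    have c4 := Finset.card_image_le (s := Finset.range (k - 1)) (f := fun i => z i * z (i + 1))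
    have c5 := Finset.card_le_two (a := z 0 * z 1 * z (k - 3) * z (k - 2))
      (b := z 0 * z 1 * z (k - 2) * z (k - 1))
    simp only [Finset.card_range] at c3 c4
    omega

lemma zmod_two (p q r s : Prop) [Decidable p] [Decidable q] [Decidable r] [Decidable s]
    (h : (if p then (1 : ZMod 2) else 0) + (if q then 1 else 0) =
      (if r then 1 else 0) + (if s then 1 else 0)) : ((p ↔ q) ↔ (r ↔ s)) := by
  by_cases p <;> by_cases q <;> by_cases r <;> by_cases s <;> simp_all <;> revert h <;> decide

lemma coordsG {G : Type*} [Group G] (k : ℕ) (B : Subgroup G)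
    (hBcomm : ∀ a ∈ B, ∀ b ∈ B, a * b = b * a)
    (hBexp : ∀ b ∈ B, b ^ 2 = 1)
    (hBcard : Nat.card B = 2 ^ k)
    (z : ℕ → G) (hzB : ∀ i < k, z i ∈ B)
    (hzgen : Subgroup.closure (z '' Set.Iio k) = B) :
    ∃ χ : G → ℕ → ZMod 2, (∀ a ∈ B, ∀ b ∈ B, χ (a * b) = χ a + χ b) ∧
      ∀ i < k, ∀ n < k, χ (z i) n = if n = i then 1 else 0 := by
  classical
  letI : CommGroup B := { (inferInstance : Group B) with
    mul_comm := fun a b => Subtype.ext (hBcomm a a.2 b b.2) }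
  obtain ⟨χ, h1, h2⟩ := exists_coords (A := B) k (fun b => Subtype.ext (hBexp b b.2)) hBcard
    (fun i : Fin k => ⟨z i, hzB i i.2⟩) (by
      apply Subgroup.map_injective B.subtype_injective
      rw [MonoidHom.map_closure, ← MonoidHom.range_eq_map, Subgroup.range_subtype]
      refine Eq.trans ?_ hzgen
      congr 1
      ext g
      constructor
      · rintro ⟨_, ⟨i, rfl⟩, rfl⟩
        exact ⟨i, i.2, rfl⟩
      · rintro ⟨i, hi, rfl⟩
        exact ⟨_, ⟨⟨i, hi⟩, rfl⟩, rfl⟩)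
  refine ⟨fun g n => if hg : g ∈ B then if hn : n < k then χ ⟨g, hg⟩ ⟨n, hn⟩ else 0 else 0, ?_, ?_⟩
  · intro a ha b hb
    funext n
    have := h1 ⟨a, ha⟩ ⟨b, hb⟩
    by_cases hn : n < k
    · simp only [Pi.add_apply, ha, hb, B.mul_mem ha hb, hn, dif_pos]
      exact congrFun this ⟨n, hn⟩
    · simp [hn]
  · intro i hi n hn
    simp only [hzB i hi, hn, dif_pos]
    have := h2 ⟨i, hi⟩ ⟨n, hn⟩
    simpa using this

end ImrichAux

open ImrichAux

/-- Let `B ≤ G` be an elementary abelian 2-group of rank `k ≥ 6`, `T` the Imrich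
generating set of `B` with respect to a generating tuple `z`, and `S ⊆ G` a set with
`S ∩ Bx = (Bx ∖ Tx) ∖ {x}`. If every automorphism of `Cay(G,S)` fixing the vertex `1`
fixes `S ∩ Bx` setwise, then every such automorphism fixes `x`. -/
theorem imrich_coset_fixes_x {G : Type*} [Group G] (k : ℕ) (hk : 6 ≤ k)
    (B : Subgroup G)
    (hBcomm : ∀ a ∈ B, ∀ b ∈ B, a * b = b * a)
    (hBexp : ∀ b ∈ B, b ^ 2 = 1)
    (hBcard : Nat.card B = 2 ^ k)
    (z : ℕ → G) (hzB : ∀ i < k, z i ∈ B)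
    (hzgen : Subgroup.closure (z '' Set.Iio k) = B)
    (T : Set G) (hT : T = imrichSet k z)
    (x : G) (S : Set G)
    (hS : S ∩ rightCosetSet B x = (rightCosetSet B x \ (· * x) '' T) \ {x})
    (hsetwise : ∀ φ : Equiv.Perm G, IsCayleyAut S φ → φ 1 = 1 →
      φ '' (S ∩ rightCosetSet B x) = S ∩ rightCosetSet B x) :
    ∀ φ : Equiv.Perm G, IsCayleyAut S φ → φ 1 = 1 → φ x = x := by
  classical
  intro φ hφ hφ1
  obtain ⟨χ, hχmul, hχz⟩ := coordsG k B hBcomm hBexp hBcard z hzB hzgen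
  have hsq : ∀ b ∈ B, b * b = 1 := fun b hb => by rw [← pow_two]; exact hBexp b hb
  have hinv : ∀ b ∈ B, b⁻¹ = b := fun b hb => inv_eq_of_mul_eq_one_left (hsq b hb)
  have helB : ∀ c : Code, c.valid k → c.el k z ∈ B := by
    intro c hc
    cases c with
    | e => exact B.one_mem
    | s i => exact hzB i hc
    | p i =>
      simp only [Code.valid] at hc
      exact B.mul_mem (hzB _ (by omega)) (hzB _ hc)
    | a => exact B.mul_mem (B.mul_mem (B.mul_mem (hzB _ (by omega)) (hzB _ (by omega)))
        (hzB _ (by omega))) (hzB _ (by omega))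
    | b => exact B.mul_mem (B.mul_mem (B.mul_mem (hzB _ (by omega)) (hzB _ (by omega)))
        (hzB _ (by omega))) (hzB _ (by omega))
  have hχ1 : χ 1 = 0 := by
    have := hχmul 1 B.one_mem 1 B.one_mem
    simpa using this
  have hχel : ∀ c : Code, c.valid k → ∀ n < k, χ (c.el k z) n = if c.mem k n then 1 else 0 := by
    intro c hc n hn
    cases c with
    | e => simp [Code.el, Code.mem, hχ1]
    | s i =>
      simp only [Code.el, Code.mem]
      rw [hχz i hc n hn]
      by_cases h1 : n = i <;> simp [h1]
    | p i =>
      simp only [Code.valid] at hc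
      simp only [Code.el, Code.mem]
      rw [hχmul _ (hzB _ (by omega)) _ (hzB _ hc), Pi.add_apply, hχz _ (by omega) n hn,
        hχz _ hc n hn]
      by_cases h1 : n = i
      · simp [h1]
      · simp [h1]
    | a =>
      simp only [Code.el, Code.mem]
      have b0 := hzB 0 (by omega)
      have b1 := hzB 1 (by omega)
      have b2 := hzB (k-3) (by omega)
      have b3 := hzB (k-2) (by omega)
      rw [hχmul _ (B.mul_mem (B.mul_mem b0 b1) b2) _ b3, hχmul _ (B.mul_mem b0 b1) _ b2,
        hχmul _ b0 _ b1]
      simp only [Pi.add_apply]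
      rw [hχz _ (by omega) n hn, hχz _ (by omega) n hn, hχz _ (by omega) n hn,
        hχz _ (by omega) n hn]
      split_ifs with h1 h2 h3 h4 h5 <;> first | omega | (simp only [add_zero, zero_add]; first | exact (if_pos (by assumption)).symm | exact (if_neg (by assumption)).symm)
    | b =>
      simp only [Code.el, Code.mem]
      have b0 := hzB 0 (by omega)
      have b1 := hzB 1 (by omega)
      have b2 := hzB (k-2) (by omega)
      have b3 := hzB (k-1) (by omega)
      rw [hχmul _ (B.mul_mem (B.mul_mem b0 b1) b2) _ b3, hχmul _ (B.mul_mem b0 b1) _ b2,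
        hχmul _ b0 _ b1]
      simp only [Pi.add_apply]
      rw [hχz _ (by omega) n hn, hχz _ (by omega) n hn, hχz _ (by omega) n hn,
        hχz _ (by omega) n hn]
      split_ifs with h1 h2 h3 h4 h5 <;> first | omega | (simp only [add_zero, zero_add]; first | exact (if_pos (by assumption)).symm | exact (if_neg (by assumption)).symm)
  have hmem4 : ∀ a b c d : Code, a.valid k → b.valid k → c.valid k → d.valid k →
      a.el k z * b.el k z = c.el k z * d.el k z →
      ∀ n < k, ((a.mem k n ↔ b.mem k n) ↔ (c.mem k n ↔ d.mem k n)) := by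
    intro a b c d ha hb hc hd h n hn
    have := congrFun (congrArg χ h) n
    rw [hχmul _ (helB a ha) _ (helB b hb), hχmul _ (helB c hc) _ (helB d hd), Pi.add_apply,
      Pi.add_apply, hχel a ha n hn, hχel b hb n hn, hχel c hc n hn, hχel d hd n hn] at this
    exact zmod_two _ _ _ _ this
  have hne : ∀ a b : Code, a.valid k → b.valid k → ∀ n < k, ¬ (a.mem k n ↔ b.mem k n) →
      a.el k z ≠ b.el k z := by
    intro a b ha hb n hn hab h
    have := hmem4 a .e b .e ha trivial hb trivial (by rw [h]) n hn
    simp only [Code.mem] at this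
    tauto
  set U : Set G := insert 1 (imrichSet k z) with hU
  have hUiff : ∀ g, g ∈ U ↔ ∃ c : Code, c.valid k ∧ g = c.el k z := imrich_subset k z
  have hUB : U ⊆ B := by
    intro g hg
    obtain ⟨c, hc, rfl⟩ := (hUiff g).1 hg
    exact helB c hc
  have h1U : (1 : G) ∈ U := Or.inl rfl
  set X := S ∩ rightCosetSet B x with hXdef
  have hX : ∀ g, g ∈ X ↔ g * x⁻¹ ∈ B ∧ g * x⁻¹ ∉ U := by
    intro g
    have m1 : g ∈ rightCosetSet B x ↔ g * x⁻¹ ∈ B := by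
      constructor
      · rintro ⟨b, hb, rfl⟩
        simpa using hb
      · intro h
        exact ⟨_, h, by simp⟩
    have m2 : g ∈ (· * x) '' T ↔ g * x⁻¹ ∈ imrichSet k z := by
      rw [hT]
      constructor
      · rintro ⟨b, hb, rfl⟩
        simpa using hb
      · intro h
        exact ⟨_, h, by simp⟩
    rw [hS, Set.mem_diff, Set.mem_diff, m1, m2, hU, Set.mem_insert_iff, Set.mem_singleton_iff,
      mul_inv_eq_one]
    tauto
  refine core B hBcomm hsq U hUB h1U ?_ ?_ ?_ x X hX φ ?_ hφ1
  · intro t ht ht1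
    obtain ⟨c, hc, rfl⟩ := (hUiff t).1 ht
    -- find a code `d` and a code `f` with `el c * el d = el f`
    suffices h : ∃ d f : Code, d.valid k ∧ f.valid k ∧ c.el k z * d.el k z = f.el k z ∧
        (∃ n < k, d.mem k n) ∧ ∃ n < k, ¬ (d.mem k n ↔ c.mem k n) by
      obtain ⟨d, f, hd, hf, hcd, ⟨n, hn, hdn⟩, ⟨m, hm, hdm⟩⟩ := h
      refine ⟨d.el k z, (hUiff _).2 ⟨d, hd, rfl⟩, ?_, ?_, ?_⟩
      · exact hne d .e hd trivial n hn (by simp only [Code.mem]; tauto)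
      · exact hne d c hd hc m hm hdm
      · rw [hcd]; exact (hUiff _).2 ⟨f, hf, rfl⟩
    cases c with
    | e => exact absurd rfl ht1
    | s i =>
      simp only [Code.valid] at hc
      by_cases hi : i + 1 < k
      · refine ⟨.s (i+1), .p i, hi, hi, rfl, ⟨i+1, hi, rfl⟩, ⟨i, hc, ?_⟩⟩
        simp [Code.mem]
      · obtain ⟨j, rfl⟩ : ∃ j, i = j + 1 := ⟨i - 1, by omega⟩
        refine ⟨.s j, .p j, ?_, hc, ?_, ⟨j, by omega, rfl⟩, ⟨j, by omega, ?_⟩⟩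
        · simp only [Code.valid]; omega
        · exact hBcomm _ (hzB _ hc) _ (hzB _ (by omega))
        · simp [Code.mem]
    | p i =>
      simp only [Code.valid] at hc
      refine ⟨.s (i+1), .s i, hc, ?_, ?_, ⟨i+1, hc, rfl⟩, ⟨i, by omega, ?_⟩⟩
      · simp only [Code.valid]; omega
      · simp only [Code.el]
        rw [mul_assoc, hsq _ (hzB _ hc), mul_one]
      · simp [Code.mem]
    | a =>
      refine ⟨.p (k-3), .p 0, ?_, ?_, ?_, ⟨k-3, by omega, Or.inl rfl⟩, ⟨0, by omega, ?_⟩⟩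
      · simp only [Code.valid]; omega
      · simp only [Code.valid]; omega
      · have e : k - 3 + 1 = k - 2 := by omega
        simp only [Code.el, e]
        have := hsq _ (B.mul_mem (hzB (k-3) (by omega)) (hzB (k-2) (by omega)))
        rw [mul_assoc (z 0 * z 1), mul_assoc (z 0 * z 1), this, mul_one]
      · intro hh; have := hh.2 (Or.inl rfl); simp only [Code.mem] at this; omega
    | b =>
      refine ⟨.p (k-2), .p 0, ?_, ?_, ?_, ⟨k-2, by omega, Or.inl rfl⟩, ⟨0, by omega, ?_⟩⟩
      · simp only [Code.valid]; omega
      · simp only [Code.valid]; omega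
      · have e : k - 2 + 1 = k - 1 := by omega
        simp only [Code.el, e]
        have := hsq _ (B.mul_mem (hzB (k-2) (by omega)) (hzB (k-1) (by omega)))
        rw [mul_assoc (z 0 * z 1), mul_assoc (z 0 * z 1), this, mul_one]
      · intro hh; have := hh.2 (Or.inl rfl); simp only [Code.mem] at this; omega
  · intro t ht ht1
    obtain ⟨c, hc, rfl⟩ := (hUiff t).1 ht
    have hce : c ≠ .e := by
      rintro rfl
      exact ht1 rfl
    have hp := partner_valid k hk c hc
    refine ⟨c.partner.el k z, (hUiff _).2 ⟨_, hp, rfl⟩, ?_⟩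
    intro s hs s' hs' h
    obtain ⟨u, hu, rfl⟩ := (hUiff s).1 hs
    obtain ⟨v, hv, rfl⟩ := (hUiff s').1 hs'
    rcases comb k hk c hc hce u v hu hv (hmem4 u v c _ hu hv hc hp h) with h | h
    · left; rw [h]
    · right; rw [h]
  · intro b hb
    by_contra hcon
    push Not at hcon
    obtain ⟨F, hF, hFc⟩ := imrich_card k hk z
    have hsub : (B : Set G) ⊆ ((F ∪ F.image (fun g => b * g) : Finset G) : Set G) := by
      intro c hc
      rw [Finset.coe_union, Finset.coe_image, hF]
      by_cases hcU : c ∈ U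
      · exact Or.inl hcU
      · refine Or.inr ⟨b * c, hcon c hc hcU, ?_⟩
        simp only
        rw [← mul_assoc, hsq b hb, one_mul]
    have c1 := Set.ncard_le_ncard hsub (Finset.finite_toSet _)
    rw [Set.ncard_coe_finset] at c1
    have c2 : (B : Set G).ncard = 2 ^ k := hBcard
    have c3 := Finset.card_union_le F (F.image (fun g => b * g))
    have c4 := Finset.card_image_le (s := F) (f := fun g => b * g)
    have c5 := pow_bound k hk
    omega
  · intro v w
    let ψ : Equiv.Perm G := (Equiv.mulRight w).trans (φ.trans (Equiv.mulRight (φ w)⁻¹))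
    have hψ : ∀ g, ψ g = φ (g * w) * (φ w)⁻¹ := fun g => rfl
    have hψaut : IsCayleyAut S ψ := by
      intro p q
      rw [hψ, hψ]
      have := hφ (p * w) (q * w)
      have e1 : q * w * (p * w)⁻¹ = q * p⁻¹ := by group
      have e2 : φ (q * w) * (φ w)⁻¹ * (φ (p * w) * (φ w)⁻¹)⁻¹ = φ (q * w) * (φ (p * w))⁻¹ := by
        group
      rw [e1] at this
      rw [e2]
      exact this
    have hs := hsetwise ψ hψaut (by rw [hψ]; simp)
    have e : φ v * (φ w)⁻¹ = ψ (v * w⁻¹) := by rw [hψ]; simp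
    rw [e]
    constructor
    · intro h
      rw [← hs]
      exact ⟨_, h, rfl⟩
    · intro h
      rw [← hs] at h
      obtain ⟨g, hg, hgv⟩ := h
      rwa [← ψ.injective hgv]
end
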